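/- Let a₁ = (1/2)√(3/2), a₂ = (1/2)(18 − 7√6), 𝐖(ρ) = −1/(a₁ρ² + a₂), and define f₁(ρ) = −9(1 + ρ² 𝐖(ρ)) and f₂(ρ) = −3ρ². There exists a constant C > 0 such that for all radial u, v, w ∈ C_c^∞(ℝ⁷, ℝ): ‖ f₁(|·|) u v ‖ ≤ C ‖u‖ ‖v‖ and ‖ f₂(|·|) u v w ‖ ≤ C ‖u‖ ‖v‖ ‖w‖, where f₁(|·|)uv denotes the radial function x ↦ f₁(|x|)u(x)v(x), and similarly for f₂(|·|)uvw. -/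

import Mathlib

open MeasureTheory Set
open scoped ENNReal

noncomputable section

abbrev E7 := EuclideanSpace ℝ (Fin 7)

/-- The Laplacian on `ℝ⁷`: `Δf(x) = ∑ᵢ ∂ᵢ²f(x)`. -/
def lap (f : E7 → ℝ) (x : E7) : ℝ :=
  ∑ i : Fin 7, iteratedFDeriv ℝ 2 f x ![EuclideanSpace.single i 1, EuclideanSpace.single i 1]

/-- A function on `ℝ⁷` is radial if it only depends on the norm of its argument. -/
def IsRadial (f : E7 → ℝ) : Prop := ∀ x y : E7, ‖x‖ = ‖y‖ → f x = f y

/-- `‖f‖² = ‖Δf‖²_{L²(ℝ⁷)} + ‖Δ²f‖²_{L²(ℝ⁷)}`. -/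
def HnormSq (f : E7 → ℝ) : ℝ≥0∞ :=
  (∫⁻ x, ENNReal.ofReal ((lap f x)^2)) + (∫⁻ x, ENNReal.ofReal ((lap (lap f) x)^2))

/-- `‖f‖ = (‖Δf‖² + ‖Δ²f‖²)^{1/2}`. -/
def Hnorm (f : E7 → ℝ) : ℝ≥0∞ := HnormSq f ^ ((1:ℝ)/2)

/-- `a₁ = (1/2)√(3/2)`. -/
def a1 : ℝ := (1/2) * Real.sqrt (3/2)

/-- `a₂ = (1/2)(18 − 7√6)`. -/
def a2 : ℝ := (1/2) * (18 - 7 * Real.sqrt 6)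

/-- The Weinkove profile `𝐖(ρ) = −1/(a₁ρ² + a₂)`. -/
def Wprof (ρ : ℝ) : ℝ := -(1 / (a1 * ρ^2 + a2))

/-- `f₁(ρ) = −9(1 + ρ²𝐖(ρ))`. -/
def f1 (ρ : ℝ) : ℝ := -9 * (1 + ρ^2 * Wprof ρ)

/-- `f₂(ρ) = −3ρ²`. -/
def f2 (ρ : ℝ) : ℝ := -3 * ρ^2

/-- generic integrated inequality from a pointwise one -/
lemma int_le_of_deriv {H h g : ℝ → ℝ} {ε R : ℝ} (hε : 0 < ε) (hR : ε ≤ R)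
    (hd : ∀ r, 0 < r → HasDerivAt H (h r) r) (hc : ContinuousOn h (Ioi 0))
    (gc : ContinuousOn g (Ioi 0)) (hle : ∀ r, 0 < r → h r ≤ g r) :
    H R - H ε ≤ ∫ r in ε..R, g r := by
  have hsub : uIcc ε R ⊆ Ioi 0 := by
    rw [uIcc_of_le hR]; intro x hx; exact lt_of_lt_of_le hε hx.1
  have hi : IntervalIntegrable h volume ε R := (hc.mono hsub).intervalIntegrable
  have gi : IntervalIntegrable g volume ε R := (gc.mono hsub).intervalIntegrable
  rw [← intervalIntegral.integral_eq_sub_of_hasDerivAt (fun x hx => hd x (hsub hx)) hi]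
  exact intervalIntegral.integral_mono_on hR hi gi
    (fun x hx => hle x (lt_of_lt_of_le hε hx.1))

lemma ii_of_cont {g : ℝ → ℝ} {ε R : ℝ} (hε : 0 < ε) (hR : ε ≤ R)
    (gc : ContinuousOn g (Ioi 0)) : IntervalIntegrable g volume ε R := by
  refine (gc.mono ?_).intervalIntegrable
  rw [uIcc_of_le hR]; intro x hx; exact lt_of_lt_of_le hε hx.1

lemma cont_of_der {F F1 : ℝ → ℝ} (hd : ∀ r, 0 < r → HasDerivAt F (r * F1 r) r) :
    ContinuousOn F (Ioi 0) := fun r hr => (hd r hr).continuousAt.continuousWithinAt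

/-- Hardy inequality -/
lemma hardy {F F1 : ℝ → ℝ} {ε R : ℝ} (b : ℕ) (hε : 0 < ε) (hR : ε ≤ R)
    (hd : ∀ r, 0 < r → HasDerivAt F (r * F1 r) r) (hc : ContinuousOn F1 (Ioi 0))
    (hF : F R = 0) :
    ((b:ℝ)+1)^2 * (∫ r in ε..R, r^b * F r ^2) ≤ 4 * ∫ r in ε..R, r^(b+4) * F1 r^2 := by
  have fc := cont_of_der hd
  have h1 : ContinuousOn (fun r => r^b * F r ^2) (Ioi 0) := by fun_prop
  have h2 : ContinuousOn (fun r => r^(b+4) * F1 r ^2) (Ioi 0) := by fun_prop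
  have key := int_le_of_deriv (H := fun r => -(2 * ((b:ℝ)+1)) * (r^(b+1) * F r ^2))
    (h := fun r => -(2 * ((b:ℝ)+1)) * (((b:ℝ)+1) * r^b * F r^2 + r^(b+1) * (2 * F r * (r * F1 r))))
    (g := fun r => 4 * (r^(b+4) * F1 r^2) - ((b:ℝ)+1)^2 * (r^b * F r ^2)) hε hR ?_ ?_ ?_ ?_
  · rw [intervalIntegral.integral_sub ((ii_of_cont hε hR h2).const_mul _)
      ((ii_of_cont hε hR h1).const_mul _)] at key
    simp only [intervalIntegral.integral_const_mul, hF] at key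
    have : 0 ≤ (2 * ((b:ℝ)+1)) * (ε^(b+1) * F ε ^2) := by positivity
    norm_num at key
    linarith
  · intro r hr
    have := ((hasDerivAt_pow (b+1) r).mul ((hd r hr).pow 2)).const_mul (-(2 * ((b:ℝ)+1)))
    convert! this using 1
    simp
  · fun_prop
  · exact (h2.const_smul (4:ℝ)).sub (h1.const_smul (((b:ℝ)+1)^2))
  · intro r hr
    have : 0 ≤ r^b * (((b:ℝ)+1) * F r + 2 * r^2 * F1 r)^2 := by positivity
    simp only [pow_succ] at this ⊢
    nlinarith

lemma hardy_sup {F F1 : ℝ → ℝ} {ε R : ℝ} (b : ℕ) (hε : 0 < ε) (hR : ε ≤ R)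
    (hd : ∀ r, 0 < r → HasDerivAt F (r * F1 r) r) (hc : ContinuousOn F1 (Ioi 0))
    (hF : F R = 0) :
    ((b:ℝ)+1) * (ε^(b+1) * F ε ^2) ≤ ∫ r in ε..R, r^(b+4) * F1 r^2 := by
  have fc := cont_of_der hd
  have h2 : ContinuousOn (fun r => r^(b+4) * F1 r ^2) (Ioi 0) := by fun_prop
  have key := int_le_of_deriv (H := fun r => -((b:ℝ)+1) * (r^(b+1) * F r ^2))
    (h := fun r => -((b:ℝ)+1) * (((b:ℝ)+1) * r^b * F r^2 + r^(b+1) * (2 * F r * (r * F1 r))))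
    (g := fun r => (r^(b+4) * F1 r^2)) hε hR ?_ ?_ h2 ?_
  · simp only [hF] at key
    norm_num at key
    linarith
  · intro r hr
    have := ((hasDerivAt_pow (b+1) r).mul ((hd r hr).pow 2)).const_mul (-((b:ℝ)+1))
    convert! this using 1
    simp
  · fun_prop
  · intro r hr
    have : 0 ≤ r^b * (((b:ℝ)+1) * F r + r^2 * F1 r)^2 := by positivity
    simp only [pow_succ] at this ⊢
    nlinarith

lemma int_anti {g : ℝ → ℝ} {δ ε R : ℝ} (hδ : 0 < δ) (h : δ ≤ ε) (hR : ε ≤ R)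
    (gc : ContinuousOn g (Ioi 0)) (g0 : ∀ r, 0 < r → 0 ≤ g r) :
    ∫ r in ε..R, g r ≤ ∫ r in δ..R, g r := by
  rw [← intervalIntegral.integral_add_adjacent_intervals (ii_of_cont hδ h gc)
    (ii_of_cont (hδ.trans_le h) hR gc)]
  have : 0 ≤ ∫ r in δ..ε, g r :=
    intervalIntegral.integral_nonneg h (fun x hx => g0 x (hδ.trans_le hx.1))
  linarith

/-- divergence identity -/
lemma divid {F F1 : ℝ → ℝ} {R E c : ℝ} (hc7 : 7 ≤ c)
    (hd : ∀ r, 0 < r → HasDerivAt F (r * F1 r) r) (hc : ContinuousOn F1 (Ioi 0))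
    (hF : F R = 0)
    (hb : Filter.Tendsto (fun r => r^7 * F r^2) (nhdsWithin 0 (Ioi 0)) (nhds 0))
    (hE : ∀ ε, 0 < ε → ε ≤ R → ∫ r in ε..R, r^6 * (r^2 * F1 r + c * F r)^2 ≤ E) :
    ∀ ε, 0 < ε → ε ≤ R → ∫ r in ε..R, r^10 * F1 r^2 ≤ E := by
  have fc := cont_of_der hd
  have h2 : ContinuousOn (fun r => r^10 * F1 r ^2) (Ioi 0) := by fun_prop
  have h1 : ContinuousOn (fun r => r^6 * (r^2 * F1 r + c * F r)^2) (Ioi 0) := by fun_prop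
  have step : ∀ ε, 0 < ε → ε ≤ R → ∫ r in ε..R, r^10 * F1 r^2 ≤ E + c * (ε^7 * F ε^2) := by
    intro ε hε hR
    have key := int_le_of_deriv (H := fun r => c * (r^7 * F r ^2))
      (h := fun r => c * (7 * r^6 * F r^2 + r^7 * (2 * F r * (r * F1 r))))
      (g := fun r => r^6 * (r^2 * F1 r + c * F r)^2 - r^10 * F1 r^2) hε hR ?_ ?_ (h1.sub h2) ?_
    · rw [intervalIntegral.integral_sub (ii_of_cont hε hR h1) (ii_of_cont hε hR h2)] at key
      simp only [hF] at key
      have := hE ε hε hR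
      norm_num at key
      linarith
    · intro r hr
      have := ((hasDerivAt_pow 7 r).mul ((hd r hr).pow 2)).const_mul c
      convert! this using 1
      simp
    · fun_prop
    · intro r hr
      have : 0 ≤ (c * (c - 7)) * (r^6 * F r^2) := by
        apply mul_nonneg (mul_nonneg (by linarith) (by linarith)); positivity
      nlinarith
  intro ε hε hR
  have lim : Filter.Tendsto (fun δ => E + c * (δ^7 * F δ^2)) (nhdsWithin 0 (Ioi 0)) (nhds E) := by
    simpa using (hb.const_mul c).const_add E
  refine ge_of_tendsto lim ?_
  filter_upwards [Ioo_mem_nhdsGT hε] with δ hδ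
  exact (int_anti hδ.1 hδ.2.le hR h2 (fun r hr => by positivity)).trans
    (step δ hδ.1 (hδ.2.le.trans hR))



structure Prof (U : ℕ → ℝ → ℝ) (R : ℝ) : Prop where
  der : ∀ k, k < 4 → ∀ r, 0 < r → HasDerivAt (U k) (r * U (k+1) r) r
  cont4 : ContinuousOn (U 4) (Ioi 0)
  van : ∀ k, k < 5 → ∀ r, R ≤ r → U k r = 0

def LU (U : ℕ → ℝ → ℝ) (r : ℝ) : ℝ := r^2 * U 2 r + 7 * U 1 r
def LLU (U : ℕ → ℝ → ℝ) (r : ℝ) : ℝ := r^4 * U 4 r + 18 * r^2 * U 3 r + 63 * U 2 r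

/-- the L2 density -/
def Qd (U : ℕ → ℝ → ℝ) (r : ℝ) : ℝ :=
  (U 0 r / r^2)^2 + (U 1 r)^2 + (U 1 r / r^2)^2 + (U 2 r)^2 + (r^2 * U 2 r)^2
    + (r^2 * U 3 r)^2 + (r^4 * U 4 r)^2

lemma Prof.cont {U : ℕ → ℝ → ℝ} {R : ℝ} (h : Prof U R) (k : ℕ) (hk : k < 5) :
    ContinuousOn (U k) (Ioi 0) := by
  rcases Nat.lt_or_ge k 4 with h4 | h4
  · exact cont_of_der (h.der k h4)
  · obtain rfl : k = 4 := by omega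
    exact h.cont4

/-- energy hypotheses -/
structure En (U : ℕ → ℝ → ℝ) (R E : ℝ) : Prop where
  pr : Prof U R
  b1 : Filter.Tendsto (fun r => r^7 * U 1 r^2) (nhdsWithin 0 (Ioi 0)) (nhds 0)
  b2 : Filter.Tendsto (fun r => r^7 * U 2 r^2) (nhdsWithin 0 (Ioi 0)) (nhds 0)
  b3 : Filter.Tendsto (fun r => r^7 * (r^2 * U 3 r + 9 * U 2 r)^2)
        (nhdsWithin 0 (Ioi 0)) (nhds 0)
  e1 : ∀ ε, 0 < ε → ε ≤ R → ∫ r in ε..R, r^6 * (LU U r)^2 ≤ E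
  e2 : ∀ ε, 0 < ε → ε ≤ R → ∫ r in ε..R, r^6 * (LLU U r)^2 ≤ E

section energy
variable {U : ℕ → ℝ → ℝ} {R E : ℝ}

lemma En.i_r10U2 (h : En U R E) : ∀ ε, 0 < ε → ε ≤ R → ∫ r in ε..R, r^10 * U 2 r^2 ≤ E :=
  divid (le_refl 7) (h.pr.der 1 (by norm_num)) (h.pr.cont 2 (by norm_num))
    (h.pr.van 1 (by norm_num) R le_rfl) h.b1 h.e1

lemma hardy7 {F F1 : ℝ → ℝ}
    (hd : ∀ r, 0 < r → HasDerivAt F (r * F1 r) r) (hc : ContinuousOn F1 (Ioi 0))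
    (hF : F R = 0) (hE : ∀ ε, 0 < ε → ε ≤ R → ∫ r in ε..R, r^10 * F1 r^2 ≤ E) :
    ∀ ε, 0 < ε → ε ≤ R → ∫ r in ε..R, r^6 * F r^2 ≤ E := by
  intro ε hε hR
  have h1 := hardy 6 hε hR hd hc hF
  have h2 := hE ε hε hR
  have h3 : 0 ≤ ∫ r in ε..R, r^6 * F r^2 :=
    intervalIntegral.integral_nonneg hR (fun x hx => by
      have := hε.trans_le hx.1; positivity)
  norm_num at h1
  linarith

lemma hardy3 {F F1 : ℝ → ℝ}
    (hd : ∀ r, 0 < r → HasDerivAt F (r * F1 r) r) (hc : ContinuousOn F1 (Ioi 0))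
    (hF : F R = 0) (hE : ∀ ε, 0 < ε → ε ≤ R → ∫ r in ε..R, r^6 * F1 r^2 ≤ E) :
    ∀ ε, 0 < ε → ε ≤ R → ∫ r in ε..R, r^2 * F r^2 ≤ E := by
  intro ε hε hR
  have h1 := hardy 2 hε hR hd hc hF
  have h2 := hE ε hε hR
  have h3 : 0 ≤ ∫ r in ε..R, r^2 * F r^2 :=
    intervalIntegral.integral_nonneg hR (fun x hx => by
      have := hε.trans_le hx.1; positivity)
  norm_num at h1
  linarith

lemma En.i_r6U1 (h : En U R E) : ∀ ε, 0 < ε → ε ≤ R → ∫ r in ε..R, r^6 * U 1 r^2 ≤ E :=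
  hardy7 (h.pr.der 1 (by norm_num)) (h.pr.cont 2 (by norm_num))
    (h.pr.van 1 (by norm_num) R le_rfl) h.i_r10U2

lemma En.i_r2U0 (h : En U R E) : ∀ ε, 0 < ε → ε ≤ R → ∫ r in ε..R, r^2 * U 0 r^2 ≤ E :=
  hardy3 (h.pr.der 0 (by norm_num)) (h.pr.cont 1 (by norm_num))
    (h.pr.van 0 (by norm_num) R le_rfl) h.i_r6U1

lemma En.dV1 (h : Prof U R) : ∀ r, 0 < r → HasDerivAt (fun r => r^2 * U 3 r + 9 * U 2 r)
    (r * (r^2 * U 4 r + 11 * U 3 r)) r := by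
  intro r hr
  have := ((hasDerivAt_pow 2 r).mul (h.der 3 (by norm_num) r hr)).add
    ((h.der 2 (by norm_num) r hr).const_mul 9)
  convert! this using 1
  norm_num
  ring

lemma En.i_r10V2 (h : En U R E) : ∀ ε, 0 < ε → ε ≤ R →
    ∫ r in ε..R, r^10 * (r^2 * U 4 r + 11 * U 3 r)^2 ≤ E := by
  have c3 := h.pr.cont 3 (by norm_num)
  have c4 := h.pr.cont 4 (by norm_num)
  refine divid (F := fun r => r^2 * U 3 r + 9 * U 2 r) (le_refl 7) (En.dV1 h.pr) (by fun_prop) ?_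
    h.b3 ?_
  · simp [h.pr.van 3 (by norm_num) R le_rfl, h.pr.van 2 (by norm_num) R le_rfl]
  · intro ε hε hR
    refine le_trans (le_of_eq ?_) (h.e2 ε hε hR)
    congr 1; ext r; unfold LLU; ring

lemma En.i_r6V1 (h : En U R E) : ∀ ε, 0 < ε → ε ≤ R →
    ∫ r in ε..R, r^6 * (r^2 * U 3 r + 9 * U 2 r)^2 ≤ E := by
  have c3 := h.pr.cont 3 (by norm_num)
  have c4 := h.pr.cont 4 (by norm_num)
  refine hardy7 (F := fun r => r^2 * U 3 r + 9 * U 2 r) (En.dV1 h.pr) (by fun_prop) ?_ h.i_r10V2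
  simp [h.pr.van 3 (by norm_num) R le_rfl, h.pr.van 2 (by norm_num) R le_rfl]

lemma En.i_r10U3 (h : En U R E) : ∀ ε, 0 < ε → ε ≤ R → ∫ r in ε..R, r^10 * U 3 r^2 ≤ E :=
  divid (by norm_num : (7:ℝ) ≤ 9) (h.pr.der 2 (by norm_num)) (h.pr.cont 3 (by norm_num))
    (h.pr.van 2 (by norm_num) R le_rfl) h.b2 h.i_r6V1

lemma En.i_r6U2 (h : En U R E) : ∀ ε, 0 < ε → ε ≤ R → ∫ r in ε..R, r^6 * U 2 r^2 ≤ E :=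
  hardy7 (h.pr.der 2 (by norm_num)) (h.pr.cont 3 (by norm_num))
    (h.pr.van 2 (by norm_num) R le_rfl) h.i_r10U3

lemma En.i_r2U1 (h : En U R E) : ∀ ε, 0 < ε → ε ≤ R → ∫ r in ε..R, r^2 * U 1 r^2 ≤ E :=
  hardy3 (h.pr.der 1 (by norm_num)) (h.pr.cont 2 (by norm_num))
    (h.pr.van 1 (by norm_num) R le_rfl) h.i_r6U2

lemma Prof.contQ (h : Prof U R) : ContinuousOn (Qd U) (Ioi 0) := by
  have c0 := h.cont 0 (by norm_num)
  have c1 := h.cont 1 (by norm_num)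
  have c2 := h.cont 2 (by norm_num)
  have c3 := h.cont 3 (by norm_num)
  have c4 := h.cont 4 (by norm_num)
  have hp : ContinuousOn (fun r : ℝ => r^2) (Ioi 0) := by fun_prop
  have hn : ∀ r ∈ Ioi (0:ℝ), r^2 ≠ 0 := fun r hr => pow_ne_zero _ (ne_of_gt hr)
  have d0 := c0.div hp hn
  have d1 := c1.div hp hn
  unfold Qd
  exact ((((((d0.pow 2).add (c1.pow 2)).add (d1.pow 2)).add (c2.pow 2)).add
    ((hp.mul c2).pow 2)).add ((hp.mul c3).pow 2)).add
    (((by fun_prop : ContinuousOn (fun r : ℝ => r^4) (Ioi 0)).mul c4).pow 2)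

lemma En.i_Q (h : En U R E) : ∀ ε, 0 < ε → ε ≤ R → ∫ r in ε..R, r^6 * Qd U r ≤ 250 * E := by
  intro ε hε hR
  have c0 := h.pr.cont 0 (by norm_num)
  have c1 := h.pr.cont 1 (by norm_num)
  have c2 := h.pr.cont 2 (by norm_num)
  have c3 := h.pr.cont 3 (by norm_num)
  have c4 := h.pr.cont 4 (by norm_num)
  have cQ := h.pr.contQ
  have i1 : IntervalIntegrable (fun r => r^2 * U 0 r^2) volume ε R :=
    ii_of_cont hε hR (by fun_prop)
  have i2 : IntervalIntegrable (fun r => r^6 * U 1 r^2) volume ε R :=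
    ii_of_cont hε hR (by fun_prop)
  have i3 : IntervalIntegrable (fun r => r^2 * U 1 r^2) volume ε R :=
    ii_of_cont hε hR (by fun_prop)
  have i4 : IntervalIntegrable (fun r => r^6 * U 2 r^2) volume ε R :=
    ii_of_cont hε hR (by fun_prop)
  have i5 : IntervalIntegrable (fun r => r^10 * U 2 r^2) volume ε R :=
    ii_of_cont hε hR (by fun_prop)
  have i6 : IntervalIntegrable (fun r => r^10 * U 3 r^2) volume ε R :=
    ii_of_cont hε hR (by fun_prop)
  have i7 : IntervalIntegrable (fun r => r^10 * (r^2 * U 4 r + 11 * U 3 r)^2) volume ε R :=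
    ii_of_cont hε hR (by fun_prop)
  have key : ∫ r in ε..R, r^6 * Qd U r ≤ ∫ r in ε..R, (r^2 * U 0 r^2 + r^6 * U 1 r^2
      + r^2 * U 1 r^2 + r^6 * U 2 r^2 + r^10 * U 2 r^2 + 243 * (r^10 * U 3 r^2)
      + 2 * (r^10 * (r^2 * U 4 r + 11 * U 3 r)^2)) := by
    refine intervalIntegral.integral_mono_on hR (ii_of_cont hε hR (by fun_prop))
      ((((((i1.add i2).add i3).add i4).add i5).add (i6.const_mul _)).add (i7.const_mul _)) ?_
    intro r hr
    have hr0 : 0 < r := hε.trans_le hr.1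
    have e1 : r^6 * (U 0 r / r^2)^2 = r^2 * U 0 r^2 := by field_simp
    have e2 : r^6 * (U 1 r / r^2)^2 = r^2 * U 1 r^2 := by field_simp
    have e3 : 0 ≤ r^10 * (r^2 * U 4 r + 22 * U 3 r)^2 := by positivity
    unfold Qd
    nlinarith
  rw [intervalIntegral.integral_add (((((i1.add i2).add i3).add i4).add i5).add (i6.const_mul _))
      (i7.const_mul _),
    intervalIntegral.integral_add ((((i1.add i2).add i3).add i4).add i5) (i6.const_mul _),
    intervalIntegral.integral_add (((i1.add i2).add i3).add i4) i5,
    intervalIntegral.integral_add ((i1.add i2).add i3) i4,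
    intervalIntegral.integral_add (i1.add i2) i3,
    intervalIntegral.integral_add i1 i2, intervalIntegral.integral_const_mul,
    intervalIntegral.integral_const_mul] at key
  have := h.i_r2U0 ε hε hR
  have := h.i_r6U1 ε hε hR
  have := h.i_r2U1 ε hε hR
  have := h.i_r6U2 ε hε hR
  have := h.i_r10U2 ε hε hR
  have := h.i_r10U3 ε hε hR
  have := h.i_r10V2 ε hε hR
  linarith

lemma sup_gen {F F1 : ℝ → ℝ} (b : ℕ) (hE0 : 0 ≤ E)
    (hd : ∀ r, 0 < r → HasDerivAt F (r * F1 r) r) (hc : ContinuousOn F1 (Ioi 0))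
    (hF : ∀ r, R ≤ r → F r = 0)
    (hE : ∀ ε, 0 < ε → ε ≤ R → ∫ r in ε..R, r^(b+4) * F1 r^2 ≤ E) :
    ∀ r, 0 < r → r^(b+1) * F r^2 ≤ E := by
  intro r hr
  rcases le_total r R with h | h
  · have h1 := hardy_sup b hr h hd hc (hF R le_rfl)
    have h2 := hE r hr h
    have h3 : 0 ≤ (b:ℝ) * (r^(b+1) * F r^2) := by positivity
    linarith
  · simp [hF r h, hE0]

lemma En.s0 (h : En U R E) (hE0 : 0 ≤ E) : ∀ r, 0 < r → r^3 * U 0 r^2 ≤ E :=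
  sup_gen 2 hE0 (h.pr.der 0 (by norm_num)) (h.pr.cont 1 (by norm_num))
    (h.pr.van 0 (by norm_num)) h.i_r6U1
lemma En.s1 (h : En U R E) (hE0 : 0 ≤ E) : ∀ r, 0 < r → r^7 * U 1 r^2 ≤ E :=
  sup_gen 6 hE0 (h.pr.der 1 (by norm_num)) (h.pr.cont 2 (by norm_num))
    (h.pr.van 1 (by norm_num)) h.i_r10U2
lemma En.s1' (h : En U R E) (hE0 : 0 ≤ E) : ∀ r, 0 < r → r^3 * U 1 r^2 ≤ E :=
  sup_gen 2 hE0 (h.pr.der 1 (by norm_num)) (h.pr.cont 2 (by norm_num))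
    (h.pr.van 1 (by norm_num)) h.i_r6U2
lemma En.s2 (h : En U R E) (hE0 : 0 ≤ E) : ∀ r, 0 < r → r^7 * U 2 r^2 ≤ E :=
  sup_gen 6 hE0 (h.pr.der 2 (by norm_num)) (h.pr.cont 3 (by norm_num))
    (h.pr.van 2 (by norm_num)) h.i_r10U3

lemma En.s00 (h : En U R E) (hE0 : 0 ≤ E) : ∀ r, 0 < r → r ≤ 1 → |U 0 r| ≤ 3 * √E := by
  intro r hr hr1
  have b1 : |U 0 1| ≤ √E := by
    have := h.s0 hE0 1 one_pos
    apply Real.abs_le_sqrt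
    linarith
  have bd : ∀ x, 0 < x → |x * U 1 x| ≤ √E / √x := by
    intro x hx
    have h1 := h.s1' hE0 x hx
    rw [← Real.sqrt_div' _ hx.le]
    apply Real.abs_le_sqrt
    rw [le_div_iff₀ hx]
    linarith
  have mono : ∀ s : ℝ, s = 1 ∨ s = -1 →
      MonotoneOn (fun x => s * U 0 x + 2 * √E * √x) (Icc r 1) := by
    intro s hs
    have dd : ∀ x, 0 < x → HasDerivAt (fun x => s * U 0 x + 2 * √E * √x)
      (s * (x * U 1 x) + 2 * √E * (1 / (2 * √x))) x := fun x hx =>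
        ((h.pr.der 0 (by norm_num) x hx).const_mul s).add
          ((Real.hasDerivAt_sqrt hx.ne').const_mul _)
    apply monotoneOn_of_deriv_nonneg (convex_Icc r 1)
    · exact fun x hx => (dd x (hr.trans_le hx.1)).continuousAt.continuousWithinAt
    · intro x hx
      rw [interior_Icc] at hx
      exact (dd x (hr.trans hx.1)).differentiableAt.differentiableWithinAt
    · intro x hx
      rw [interior_Icc] at hx
      have hx0 := hr.trans hx.1
      rw [(dd x hx0).deriv]
      have h3 := abs_le.1 (bd x hx0)
      have h4 : 2 * √E * (1 / (2 * √x)) = √E / √x := by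
        field_simp
      rw [h4]
      rcases hs with rfl | rfl <;> linarith [h3.1, h3.2]
  have m1 := mono 1 (Or.inl rfl) (left_mem_Icc.2 hr1) (right_mem_Icc.2 hr1) hr1
  have m2 := mono (-1) (Or.inr rfl) (left_mem_Icc.2 hr1) (right_mem_Icc.2 hr1) hr1
  simp only [Real.sqrt_one] at m1 m2
  have h5 : 0 ≤ √E * √r := by positivity
  have h6 := abs_le.1 b1
  rw [abs_le]
  constructor <;> linarith [h6.1, h6.2]

/-- pointwise bounds -/
structure Bd (r u0 u1 u2 u3 u4 P M : ℝ) : Prop where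
  p0 : |u0| ≤ r^2 * P
  p1 : |u1| ≤ P
  p1' : |u1| ≤ r^2 * P
  p2 : |u2| ≤ P
  p2' : r^2 * |u2| ≤ P
  p3 : r^2 * |u3| ≤ P
  p4 : r^4 * |u4| ≤ P
  m0 : |u0| ≤ M
  m0' : r * |u0| ≤ M
  m1 : r^2 * |u1| ≤ M
  m1' : r^3 * |u1| ≤ M
  m2 : r ≤ 1 → r^4 * |u2| ≤ M
  m2' : 1 ≤ r → r^3 * |u2| ≤ M

lemma sq_bd {x r E : ℝ} {k : ℕ} (hr : 0 < r) (h : r^(2*k) * x^2 ≤ E) : r^k * |x| ≤ 3 * √E := by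
  have h1 : |r^k * x| ≤ √E := by
    apply Real.abs_le_sqrt
    calc (r^k * x)^2 = r^(2*k) * x^2 := by ring
      _ ≤ E := h
  rw [abs_mul, abs_of_pos (pow_pos hr k)] at h1
  linarith [Real.sqrt_nonneg E]

lemma En.bd (h : En U R E) (hE0 : 0 ≤ E) (r : ℝ) (hr : 0 < r) :
    Bd r (U 0 r) (U 1 r) (U 2 r) (U 3 r) (U 4 r) (√(Qd U r)) (3 * √E) := by
  have q : ∀ x : ℝ, x^2 ≤ Qd U r → |x| ≤ √(Qd U r) := fun x hx => Real.abs_le_sqrt hx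
  have n1 := sq_nonneg (U 0 r / r^2)
  have n2 := sq_nonneg (U 1 r)
  have n3 := sq_nonneg (U 1 r / r^2)
  have n4 := sq_nonneg (U 2 r)
  have n5 := sq_nonneg (r^2 * U 2 r)
  have n6 := sq_nonneg (r^2 * U 3 r)
  have n7 := sq_nonneg (r^4 * U 4 r)
  have sq2 : |r^2| = r^2 := abs_of_pos (by positivity)
  have sq4 : |r^4| = r^4 := abs_of_pos (by positivity)
  have s0 := h.s0 hE0 r hr
  have s1 := h.s1 hE0 r hr
  have s1' := h.s1' hE0 r hr
  have s2 := h.s2 hE0 r hr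
  have lo : ∀ (x : ℝ) (a b : ℕ), a ≤ b → r ≤ 1 → r^a * x^2 ≤ E → r^b * x^2 ≤ E := by
    intro x a b hab h1 hx
    exact (mul_le_mul_of_nonneg_right (pow_le_pow_of_le_one hr.le h1 hab) (sq_nonneg x)).trans hx
  have hi : ∀ (x : ℝ) (a b : ℕ), b ≤ a → 1 ≤ r → r^a * x^2 ≤ E → r^b * x^2 ≤ E := by
    intro x a b hab h1 hx
    exact (mul_le_mul_of_nonneg_right (pow_le_pow_right₀ h1 hab) (sq_nonneg x)).trans hx
  constructor
  · have := q (U 0 r / r^2) (by unfold Qd; linarith)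
    rw [abs_div, sq2, div_le_iff₀ (by positivity)] at this
    linarith
  · exact q _ (by unfold Qd; linarith)
  · have := q (U 1 r / r^2) (by unfold Qd; linarith)
    rw [abs_div, sq2, div_le_iff₀ (by positivity)] at this
    linarith
  · exact q _ (by unfold Qd; linarith)
  · have := q (r^2 * U 2 r) (by unfold Qd; linarith)
    rwa [abs_mul, sq2] at this
  · have := q (r^2 * U 3 r) (by unfold Qd; linarith)
    rwa [abs_mul, sq2] at this
  · have := q (r^4 * U 4 r) (by unfold Qd; linarith)
    rwa [abs_mul, sq4] at this
  · rcases le_total r 1 with h1 | h1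
    · exact h.s00 hE0 r hr h1
    · have := sq_bd (k := 0) hr (hi (U 0 r) 3 0 (by norm_num) h1 s0)
      simpa using this
  · rcases le_total r 1 with h1 | h1
    · have h2 := h.s00 hE0 r hr h1
      have h3 := mul_le_mul_of_nonneg_right h1 (abs_nonneg (U 0 r))
      linarith
    · have := sq_bd (k := 1) hr (hi (U 0 r) 3 2 (by norm_num) h1 s0)
      simpa using this
  · rcases le_total r 1 with h1 | h1
    · exact sq_bd (k := 2) hr (lo (U 1 r) 3 4 (by norm_num) h1 s1')
    · exact sq_bd (k := 2) hr (hi (U 1 r) 7 4 (by norm_num) h1 s1)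
  · rcases le_total r 1 with h1 | h1
    · exact sq_bd (k := 3) hr (lo (U 1 r) 3 6 (by norm_num) h1 s1')
    · exact sq_bd (k := 3) hr (hi (U 1 r) 7 6 (by norm_num) h1 s1)
  · intro h1
    exact sq_bd (k := 4) hr (lo (U 2 r) 7 8 (by norm_num) h1 s2)
  · intro h1
    exact sq_bd (k := 3) hr (hi (U 2 r) 7 6 (by norm_num) h1 s2)

end energy



lemma mm {a b c x y A B : ℝ} (ha : 0 ≤ a) (hb : 0 ≤ b) (h1 : a * |x| ≤ A) (h2 : b * |y| ≤ B)
    (hc : c = a * b) : c * |x * y| ≤ A * B := by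
  subst hc
  rw [abs_mul]
  calc a * b * (|x| * |y|) = (a * |x|) * (b * |y|) := by ring
    _ ≤ A * B := mul_le_mul h1 h2 (by positivity) (le_trans (by positivity) h1)

lemma tri2 (x y : ℝ) : |x + y| ≤ |x| + |y| := abs_add_le x y
lemma tri3 (x y z : ℝ) : |x + 2 * y + z| ≤ |x| + 2 * |y| + |z| := by
  have h1 := abs_add_le (x + 2*y) z
  have h2 := abs_add_le x (2*y)
  rw [abs_mul, abs_two] at h2
  linarith
lemma tri4 (x y z w : ℝ) : |x + 3 * y + 3 * z + w| ≤ |x| + 3 * |y| + 3 * |z| + |w| := by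
  have h1 := abs_add_le (x + 3*y + 3*z) w
  have h2 := abs_add_le (x + 3*y) (3*z)
  have h3 := abs_add_le x (3*y)
  rw [abs_mul, abs_of_pos (by norm_num : (0:ℝ) < 3)] at h2 h3
  linarith
lemma tri5 (x y z w v : ℝ) :
    |x + 4 * y + 6 * z + 4 * w + v| ≤ |x| + 4 * |y| + 6 * |z| + 4 * |w| + |v| := by
  have h1 := abs_add_le (x + 4*y + 6*z + 4*w) v
  have h2 := abs_add_le (x + 4*y + 6*z) (4*w)
  have h3 := abs_add_le (x + 4*y) (6*z)
  have h4 := abs_add_le x (4*y)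
  rw [abs_mul, abs_of_pos (by norm_num : (0:ℝ) < 4)] at h2 h4
  rw [abs_mul, abs_of_pos (by norm_num : (0:ℝ) < 6)] at h3
  linarith

structure GB (r g0 g1 g2 g3 g4 S T : ℝ) : Prop where
  a0 : |g0| ≤ r^2 * S
  a1 : |g1| ≤ 2 * S
  a1' : r * |g1| ≤ 2 * S
  a2 : |g2| ≤ 4 * S
  a2' : r^2 * |g2| ≤ 4 * S
  a2'' : r^3 * |g2| ≤ 4 * S
  a3 : r^2 * |g3| ≤ 8 * S
  a3' : r^3 * |g3| ≤ 8 * S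
  a4 : r^4 * |g4| ≤ 16 * S
  a4' : r^5 * |g4| ≤ 16 * S
  t0 : |g0| ≤ T
  t0' : r^2 * |g0| ≤ T
  t1 : r^4 * |g1| ≤ 2 * T
  t2 : r ≤ 1 → r^6 * |g2| ≤ 4 * T
  t2' : 1 ≤ r → r^4 * |g2| ≤ 4 * T

lemma le_of_sum {c x s B : ℝ} (hc : 0 ≤ c) (h : x ≤ s) (hs : c * s ≤ B) : c * x ≤ B :=
  (mul_le_mul_of_nonneg_left h hc).trans hs

lemma Bd.P0 {r u0 u1 u2 u3 u4 P M : ℝ} (h : Bd r u0 u1 u2 u3 u4 P M) : 0 ≤ P :=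
  (abs_nonneg _).trans h.p1
lemma Bd.M0 {r u0 u1 u2 u3 u4 P M : ℝ} (h : Bd r u0 u1 u2 u3 u4 P M) : 0 ≤ M :=
  (abs_nonneg _).trans h.m0

lemma one_mul_le {x y : ℝ} (h : x ≤ y) : 1 * x ≤ y := by rwa [one_mul]

lemma GB_of {r u0 u1 u2 u3 u4 P M v0 v1 v2 v3 v4 Q N : ℝ} (hr : 0 < r)
    (hu : Bd r u0 u1 u2 u3 u4 P M) (hv : Bd r v0 v1 v2 v3 v4 Q N) :
    GB r (u0 * v0) (u0 * v1 + u1 * v0) (u0 * v2 + 2 * (u1 * v1) + u2 * v0)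
      (u0 * v3 + 3 * (u1 * v2) + 3 * (u2 * v1) + u3 * v0)
      (u0 * v4 + 4 * (u1 * v3) + 6 * (u2 * v2) + 4 * (u3 * v1) + u4 * v0)
      (P * N + M * Q) (M * N) := by
  have hP := hu.P0
  have hM := hu.M0
  have hQ := hv.P0
  have hN := hv.M0
  have hPN : 0 ≤ P * N := by positivity
  have hMQ : 0 ≤ M * Q := by positivity
  have z0 : (0:ℝ) ≤ 1 := zero_le_one
  have z1 : 0 ≤ r := hr.le
  have z2 : 0 ≤ r^2 := by positivity
  have z3 : 0 ≤ r^3 := by positivity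
  have z4 : 0 ≤ r^4 := by positivity
  have z5 : 0 ≤ r^5 := by positivity
  have z6 : 0 ≤ r^6 := by positivity
  have up0 := one_mul_le hu.p0
  have up1 := one_mul_le hu.p1
  have up2 := one_mul_le hu.p2
  have um0 := one_mul_le hu.m0
  have vp0 := one_mul_le hv.p0
  have vp1 := one_mul_le hv.p1
  have vp2 := one_mul_le hv.p2
  have vm0 := one_mul_le hv.m0
  -- u1 v1 : case free bound
  have k11 : 1 * |u1 * v1| ≤ P * N := by
    have h := mm z0 z2 (one_mul_le hu.p1') hv.m1 rfl
    have h' : r^2 * (1 * |u1 * v1|) ≤ r^2 * (P * N) := by linarith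
    exact le_of_mul_le_mul_left h' (by positivity)
  have k22a : ∀ c, 0 ≤ c → (r ≤ 1 → c ≤ r^4) → (1 ≤ r → c ≤ r^5) → c * |u2 * v2| ≤ P * N := by
    intro c hc h1 h2
    rcases le_total r 1 with h | h
    · exact (mul_le_mul_of_nonneg_right (h1 h) (abs_nonneg _)).trans
        (mm z0 z4 up2 (hv.m2 h) (by ring))
    · exact (mul_le_mul_of_nonneg_right (h2 h) (abs_nonneg _)).trans
        (mm z2 z3 hu.p2' (hv.m2' h) (by ring))
  constructor
  · have := mm z0 z0 up0 vm0 rfl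
    have h2 : 0 ≤ r^2 * (M * Q) := by positivity
    linarith
  · have := mm z0 z0 um0 vp1 rfl
    have := mm z0 z0 up1 vm0 rfl
    linarith [tri2 (u0 * v1) (u1 * v0)]
  · have := mm z1 z0 hu.m0' vp1 (c := r) (by ring)
    have := mm z0 z1 up1 hv.m0' (c := r) (by ring)
    exact le_of_sum z1 (tri2 (u0 * v1) (u1 * v0)) (by linarith)
  · have := mm z0 z0 um0 vp2 rfl
    have := mm z0 z0 up2 vm0 rfl
    linarith [tri3 (u0 * v2) (u1 * v1) (u2 * v0)]
  · have := mm z0 z2 um0 hv.p2' (c := r^2) (by ring)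
    have := mm z2 z0 hu.p2' vm0 (c := r^2) (by ring)
    have := mm z0 z2 up1 hv.m1 (c := r^2) (by ring)
    exact le_of_sum z2 (tri3 (u0 * v2) (u1 * v1) (u2 * v0)) (by linarith)
  · have := mm z1 z2 hu.m0' hv.p2' (c := r^3) (by ring)
    have := mm z2 z1 hu.p2' hv.m0' (c := r^3) (by ring)
    have := mm z0 z3 up1 hv.m1' (c := r^3) (by ring)
    exact le_of_sum z3 (tri3 (u0 * v2) (u1 * v1) (u2 * v0)) (by linarith)
  · have := mm z0 z2 um0 hv.p3 (c := r^2) (by ring)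
    have := mm z2 z0 hu.p3 vm0 (c := r^2) (by ring)
    have := mm z0 z2 up2 hv.m1 (c := r^2) (by ring)
    have := mm z2 z0 hu.m1 vp2 (c := r^2) (by ring)
    exact le_of_sum z2 (tri4 (u0 * v3) (u1 * v2) (u2 * v1) (u3 * v0)) (by linarith)
  · have := mm z1 z2 hu.m0' hv.p3 (c := r^3) (by ring)
    have := mm z2 z1 hu.p3 hv.m0' (c := r^3) (by ring)
    have := mm z0 z3 up2 hv.m1' (c := r^3) (by ring)
    have := mm z3 z0 hu.m1' vp2 (c := r^3) (by ring)
    exact le_of_sum z3 (tri4 (u0 * v3) (u1 * v2) (u2 * v1) (u3 * v0)) (by linarith)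
  · have := mm z0 z4 um0 hv.p4 (c := r^4) (by ring)
    have := mm z4 z0 hu.p4 vm0 (c := r^4) (by ring)
    have := mm z2 z2 hu.p3 hv.m1 (c := r^4) (by ring)
    have := mm z2 z2 hu.m1 hv.p3 (c := r^4) (by ring)
    have := k22a (r^4) z4 (fun _ => le_rfl)
      (fun h => pow_le_pow_right₀ h (by norm_num))
    exact le_of_sum z4 (tri5 (u0 * v4) (u1 * v3) (u2 * v2) (u3 * v1) (u4 * v0)) (by linarith)
  · have := mm z1 z4 hu.m0' hv.p4 (c := r^5) (by ring)
    have := mm z4 z1 hu.p4 hv.m0' (c := r^5) (by ring)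
    have := mm z2 z3 hu.p3 hv.m1' (c := r^5) (by ring)
    have := mm z3 z2 hu.m1' hv.p3 (c := r^5) (by ring)
    have := k22a (r^5) z5
      (fun h => pow_le_pow_of_le_one hr.le h (by norm_num)) (fun _ => le_rfl)
    exact le_of_sum z5 (tri5 (u0 * v4) (u1 * v3) (u2 * v2) (u3 * v1) (u4 * v0)) (by linarith)
  · have := mm z0 z0 um0 vm0 rfl
    linarith
  · exact mm z1 z1 hu.m0' hv.m0' (by ring)
  · have := mm z1 z3 hu.m0' hv.m1' (c := r^4) (by ring)
    have := mm z3 z1 hu.m1' hv.m0' (c := r^4) (by ring)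
    exact le_of_sum z4 (tri2 (u0 * v1) (u1 * v0)) (by linarith)
  · intro h
    have h6 : r^6 ≤ r^4 := pow_le_pow_of_le_one hr.le h (by norm_num)
    have e1 := mm z0 z4 um0 (hv.m2 h) (c := r^4) (by ring)
    have e2 := mm z4 z0 (hu.m2 h) vm0 (c := r^4) (by ring)
    have := mul_le_mul_of_nonneg_right h6 (abs_nonneg (u0 * v2))
    have := mul_le_mul_of_nonneg_right h6 (abs_nonneg (u2 * v0))
    have := mm z3 z3 hu.m1' hv.m1' (c := r^6) (by ring)
    exact le_of_sum z6 (tri3 (u0 * v2) (u1 * v1) (u2 * v0)) (by linarith)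
  · intro h
    have := mm z1 z3 hu.m0' (hv.m2' h) (c := r^4) (by ring)
    have := mm z3 z1 (hu.m2' h) hv.m0' (c := r^4) (by ring)
    have := mm z2 z2 hu.m1 hv.m1 (c := r^4) (by ring)
    exact le_of_sum z4 (tri3 (u0 * v2) (u1 * v1) (u2 * v0)) (by linarith)

/-- coefficient bounds -/
structure FB (r f0 f1 f2 f3 f4 K : ℝ) : Prop where
  c0 : |f0| ≤ K
  c1 : |f1| ≤ K
  c1' : r^2 * |f1| ≤ K
  c2 : r^2 * |f2| ≤ K
  c2' : r^4 * |f2| ≤ K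
  c2'' : |f2| ≤ K
  c3 : r^2 * |f3| ≤ K
  c3' : r^4 * |f3| ≤ K
  c4 : r^6 * |f4| ≤ K

def S1 (r p1 p2 : ℝ) : ℝ := r^2 * p2 + 7 * p1
def S2 (r p2 p3 p4 : ℝ) : ℝ := r^4 * p4 + 18 * r^2 * p3 + 63 * p2

lemma S1_le {r p1 p2 A B : ℝ} (h1 : |p1| ≤ A) (h2 : r^2 * |p2| ≤ B) :
    |S1 r p1 p2| ≤ 7 * A + B := by
  unfold S1
  have := abs_add_le (r^2 * p2) (7 * p1)
  rw [abs_mul, abs_mul, abs_of_nonneg (sq_nonneg r), abs_of_pos (by norm_num : (0:ℝ) < 7)] at this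
  linarith
lemma S2_le {r p2 p3 p4 A B C : ℝ} (h1 : |p2| ≤ A) (h2 : r^2 * |p3| ≤ B) (h3 : r^4 * |p4| ≤ C) :
    |S2 r p2 p3 p4| ≤ 63 * A + 18 * B + C := by
  unfold S2
  have h := abs_add_le (r^4 * p4 + 18 * r^2 * p3) (63 * p2)
  have h' := abs_add_le (r^4 * p4) (18 * r^2 * p3)
  have z4 : 0 ≤ r^4 := by positivity
  rw [abs_mul 63, abs_of_pos (by norm_num : (0:ℝ) < 63)] at h
  rw [abs_mul, abs_mul (18 * r^2), abs_of_nonneg z4,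
    abs_of_nonneg (by positivity : 0 ≤ 18 * r^2)] at h'
  linarith

lemma quad {r f0 f1 f2 f3 f4 K g0 g1 g2 g3 g4 S T : ℝ} (hr : 0 < r)
    (hf : FB r f0 f1 f2 f3 f4 K) (hg : GB r g0 g1 g2 g3 g4 S T) :
    |S1 r (f0 * g1 + f1 * g0) (f0 * g2 + 2 * (f1 * g1) + f2 * g0)| ≤ 10000 * (K * S) ∧
    |S2 r (f0 * g2 + 2 * (f1 * g1) + f2 * g0)
      (f0 * g3 + 3 * (f1 * g2) + 3 * (f2 * g1) + f3 * g0)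
      (f0 * g4 + 4 * (f1 * g3) + 6 * (f2 * g2) + 4 * (f3 * g1) + f4 * g0)| ≤ 10000 * (K * S) := by
  have hK : 0 ≤ K := (abs_nonneg _).trans hf.c0
  have hS : 0 ≤ S := by linarith [(abs_nonneg _).trans hg.a1]
  have hKS : 0 ≤ K * S := by positivity
  have z0 : (0:ℝ) ≤ 1 := zero_le_one
  have z2 : 0 ≤ r^2 := by positivity
  have z4 : 0 ≤ r^4 := by positivity
  have z6 : 0 ≤ r^6 := by positivity
  have c0 := one_mul_le hf.c0
  have c1 := one_mul_le hf.c1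
  have c2 := one_mul_le hf.c2''
  have a1 := one_mul_le hg.a1
  have a2 := one_mul_le hg.a2
  -- g0 bound in divided form
  have g0b : ∀ (f : ℝ) (j : ℕ), r^(j+2) * |f| ≤ K → r^j * |f * g0| ≤ K * S := by
    intro f j h
    have h1 := mm (by positivity) z0 h (one_mul_le hg.a0) rfl
    have h2 : r^2 * (r^j * |f * g0|) ≤ r^2 * (K * S) := by
      calc _ = r^(j+2) * 1 * |f * g0| := by ring
        _ ≤ _ := h1
        _ = _ := by ring
    exact le_of_mul_le_mul_left h2 (by positivity)
  have p1 : |f0 * g1 + f1 * g0| ≤ 10 * (K * S) := by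
    have := mm z0 z0 c0 a1 rfl
    have := g0b f1 0 (by simpa using hf.c1')
    rw [pow_zero] at this
    linarith [tri2 (f0 * g1) (f1 * g0)]
  have p2 : |f0 * g2 + 2 * (f1 * g1) + f2 * g0| ≤ 10 * (K * S) := by
    have := mm z0 z0 c0 a2 rfl
    have := mm z0 z0 c1 a1 rfl
    have := g0b f2 0 (by simpa using hf.c2)
    rw [pow_zero] at this
    linarith [tri3 (f0 * g2) (f1 * g1) (f2 * g0)]
  have p2' : r^2 * |f0 * g2 + 2 * (f1 * g1) + f2 * g0| ≤ 10 * (K * S) := by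
    have := mm z0 z2 c0 hg.a2' (c := r^2) (by ring)
    have := mm z2 z0 hf.c1' a1 (c := r^2) (by ring)
    have := g0b f2 2 hf.c2'
    exact le_of_sum z2 (tri3 (f0 * g2) (f1 * g1) (f2 * g0)) (by linarith)
  have p3 : r^2 * |f0 * g3 + 3 * (f1 * g2) + 3 * (f2 * g1) + f3 * g0| ≤ 50 * (K * S) := by
    have := mm z0 z2 c0 hg.a3 (c := r^2) (by ring)
    have := mm z2 z0 hf.c1' a2 (c := r^2) (by ring)
    have := mm z2 z0 hf.c2 a1 (c := r^2) (by ring)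
    have := g0b f3 2 hf.c3'
    exact le_of_sum z2 (tri4 (f0 * g3) (f1 * g2) (f2 * g1) (f3 * g0)) (by linarith)
  have p4 : r^4 * |f0 * g4 + 4 * (f1 * g3) + 6 * (f2 * g2) + 4 * (f3 * g1) + f4 * g0|
      ≤ 200 * (K * S) := by
    have := mm z0 z4 c0 hg.a4 (c := r^4) (by ring)
    have := mm z2 z2 hf.c1' hg.a3 (c := r^4) (by ring)
    have := mm z4 z0 hf.c2' a2 (c := r^4) (by ring)
    have := mm z4 z0 hf.c3' a1 (c := r^4) (by ring)
    have := g0b f4 4 hf.c4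
    exact le_of_sum z4 (tri5 (f0 * g4) (f1 * g3) (f2 * g2) (f3 * g1) (f4 * g0)) (by linarith)
  exact ⟨(S1_le p1 p2').trans (by linarith), (S2_le p2 p3 p4).trans (by linarith)⟩

lemma cub {r u0 u1 u2 u3 u4 P M g0 g1 g2 g3 g4 S T : ℝ} (hr : 0 < r)
    (hu : Bd r u0 u1 u2 u3 u4 P M) (hg : GB r g0 g1 g2 g3 g4 S T)
    {h0 h1 h2 h3 h4 : ℝ}
    (e0 : h0 = u0 * g0) (e1 : h1 = u0 * g1 + u1 * g0) (e2 : h2 = u0 * g2 + 2 * (u1 * g1) + u2 * g0)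
    (e3 : h3 = u0 * g3 + 3 * (u1 * g2) + 3 * (u2 * g1) + u3 * g0)
    (e4 : h4 = u0 * g4 + 4 * (u1 * g3) + 6 * (u2 * g2) + 4 * (u3 * g1) + u4 * g0) :
    |S1 r (-3 * r^2 * h1 + -6 * h0) (-3 * r^2 * h2 + 2 * (-6 * h1) + 0 * h0)|
      ≤ 100000 * (P * T + M * S) ∧
    |S2 r (-3 * r^2 * h2 + 2 * (-6 * h1) + 0 * h0)
      (-3 * r^2 * h3 + 3 * (-6 * h2) + 3 * (0 * h1) + 0 * h0)
      (-3 * r^2 * h4 + 4 * (-6 * h3) + 6 * (0 * h2) + 4 * (0 * h1) + 0 * h0)|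
      ≤ 100000 * (P * T + M * S) := by
  have hP := hu.P0
  have hM := hu.M0
  have hS : 0 ≤ S := by linarith [(abs_nonneg _).trans hg.a1]
  have hT : 0 ≤ T := (abs_nonneg _).trans hg.t0
  have hPT : 0 ≤ P * T := by positivity
  have hMS : 0 ≤ M * S := by positivity
  have z0 : (0:ℝ) ≤ 1 := zero_le_one
  have z1 : 0 ≤ r := hr.le
  have z2 : 0 ≤ r^2 := by positivity
  have z3 : 0 ≤ r^3 := by positivity
  have z4 : 0 ≤ r^4 := by positivity
  have z5 : 0 ≤ r^5 := by positivity
  have z6 : 0 ≤ r^6 := by positivity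
  have up0 := one_mul_le hu.p0
  have up1 := one_mul_le hu.p1
  have up2 := one_mul_le hu.p2
  have um0 := one_mul_le hu.m0
  have a1 := one_mul_le hg.a1
  have a2 := one_mul_le hg.a2
  have t0 := one_mul_le hg.t0
  have B0 : |h0| ≤ P * T := by
    have h := mm z0 z2 up0 hg.t0' (c := r^2) (by ring)
    rw [e0]
    exact le_of_mul_le_mul_left (by linarith : r^2 * |u0 * g0| ≤ r^2 * (P * T)) (by positivity)
  have B1 : |h1| ≤ 4 * (P * T + M * S) := by
    have := mm z0 z0 um0 a1 rfl
    have := mm z0 z0 up1 t0 rfl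
    rw [e1]
    linarith [tri2 (u0 * g1) (u1 * g0)]
  have B1' : r^2 * |h1| ≤ 4 * (P * T + M * S) := by
    have := mm z1 z1 hu.m0' hg.a1' (c := r^2) (by ring)
    have := mm z0 z2 up1 hg.t0' (c := r^2) (by ring)
    rw [e1]
    exact le_of_sum z2 (tri2 (u0 * g1) (u1 * g0)) (by linarith)
  have B2 : r^2 * |h2| ≤ 20 * (P * T + M * S) := by
    have := mm z0 z2 um0 hg.a2' (c := r^2) (by ring)
    have := mm z2 z0 hu.m1 a1 (c := r^2) (by ring)
    have := mm z0 z2 up2 hg.t0' (c := r^2) (by ring)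
    rw [e2]
    exact le_of_sum z2 (tri3 (u0 * g2) (u1 * g1) (u2 * g0)) (by linarith)
  have B2' : r^4 * |h2| ≤ 20 * (P * T + M * S) := by
    have := mm z1 z3 hu.m0' hg.a2'' (c := r^4) (by ring)
    have := mm z0 z4 up1 hg.t1 (c := r^4) (by ring)
    have := mm z2 z2 hu.p2' hg.t0' (c := r^4) (by ring)
    rw [e2]
    exact le_of_sum z4 (tri3 (u0 * g2) (u1 * g1) (u2 * g0)) (by linarith)
  have B3 : r^4 * |h3| ≤ 50 * (P * T + M * S) := by
    have := mm z1 z3 hu.m0' hg.a3' (c := r^4) (by ring)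
    have := mm z2 z2 hu.m1 hg.a2' (c := r^4) (by ring)
    have := mm z0 z4 up2 hg.t1 (c := r^4) (by ring)
    have := mm z2 z2 hu.p3 hg.t0' (c := r^4) (by ring)
    rw [e3]
    exact le_of_sum z4 (tri4 (u0 * g3) (u1 * g2) (u2 * g1) (u3 * g0)) (by linarith)
  have B4 : r^6 * |h4| ≤ 200 * (P * T + M * S) := by
    have := mm z1 z5 hu.m0' hg.a4' (c := r^6) (by ring)
    have := mm z3 z3 hu.m1' hg.a3' (c := r^6) (by ring)
    have : r^6 * |u2 * g2| ≤ P * (4 * T) := by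
      rcases le_total r 1 with h | h
      · exact mm z0 z6 up2 (hg.t2 h) (by ring)
      · exact mm z2 z4 hu.p2' (hg.t2' h) (by ring)
    have := mm z2 z4 hu.p3 hg.t1 (c := r^6) (by ring)
    have := mm z4 z2 hu.p4 hg.t0' (c := r^6) (by ring)
    rw [e4]
    exact le_of_sum z6 (tri5 (u0 * g4) (u1 * g3) (u2 * g2) (u3 * g1) (u4 * g0)) (by linarith)
  clear e0 e1 e2 e3 e4
  have A : ∀ x y a b : ℝ, |a * x + b * y| ≤ |a| * |x| + |b| * |y| := by
    intro x y a b
    rw [← abs_mul, ← abs_mul]; exact abs_add_le _ _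
  have r3 : |(-3) * r^2| = 3 * r^2 := by
    rw [abs_mul, abs_of_nonneg z2]; norm_num
  have n6 : |(-6:ℝ)| = 6 := by norm_num
  have n12 : |(-12:ℝ)| = 12 := by norm_num
  have n18 : |(-18:ℝ)| = 18 := by norm_num
  have n24 : |(-24:ℝ)| = 24 := by norm_num
  have q1 : |-3 * r^2 * h1 + -6 * h0| ≤ 20 * (P * T + M * S) := by
    have := A h1 h0 (-3 * r^2) (-6)
    rw [r3, n6] at this
    linarith
  have w2 : |-3 * r^2 * h2 + 2 * (-6 * h1) + 0 * h0| ≤ 3 * r^2 * |h2| + 12 * |h1| := by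
    have := A h2 h1 (-3 * r^2) (-12)
    rw [r3, n12] at this
    convert this using 2; ring
  have w3 : |-3 * r^2 * h3 + 3 * (-6 * h2) + 3 * (0 * h1) + 0 * h0| ≤ 3 * r^2 * |h3| + 18 * |h2| := by
    have := A h3 h2 (-3 * r^2) (-18)
    rw [r3, n18] at this
    convert this using 2; ring
  have w4 : |-3 * r^2 * h4 + 4 * (-6 * h3) + 6 * (0 * h2) + 4 * (0 * h1) + 0 * h0|
      ≤ 3 * r^2 * |h4| + 24 * |h3| := by
    have := A h4 h3 (-3 * r^2) (-24)
    rw [r3, n24] at this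
    convert this using 2; ring
  have q2 := w2.trans (by linarith : _ ≤ 200 * (P * T + M * S))
  have q2' := le_of_sum z2 w2 (by linarith : _ ≤ 200 * (P * T + M * S))
  have q3 := le_of_sum z2 w3 (by linarith : _ ≤ 1000 * (P * T + M * S))
  have q4 := le_of_sum z4 w4 (by linarith : _ ≤ 3000 * (P * T + M * S))
  exact ⟨(S1_le q1 q2').trans (by linarith), (S2_le q2 q3 q4).trans (by linarith)⟩



structure D4 (U : ℕ → ℝ → ℝ) : Prop where
  der : ∀ k, k < 4 → ∀ r, 0 < r → HasDerivAt (U k) (r * U (k+1) r) r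
  cont4 : ContinuousOn (U 4) (Ioi 0)

def conv (U V : ℕ → ℝ → ℝ) : ℕ → ℝ → ℝ
  | 0 => fun r => U 0 r * V 0 r
  | 1 => fun r => U 0 r * V 1 r + U 1 r * V 0 r
  | 2 => fun r => U 0 r * V 2 r + 2 * (U 1 r * V 1 r) + U 2 r * V 0 r
  | 3 => fun r => U 0 r * V 3 r + 3 * (U 1 r * V 2 r) + 3 * (U 2 r * V 1 r) + U 3 r * V 0 r
  | 4 => fun r => U 0 r * V 4 r + 4 * (U 1 r * V 3 r) + 6 * (U 2 r * V 2 r)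
      + 4 * (U 3 r * V 1 r) + U 4 r * V 0 r
  | _ => fun _ => 0

lemma Prof.d4 {U : ℕ → ℝ → ℝ} {R : ℝ} (h : Prof U R) : D4 U := ⟨h.der, h.cont4⟩

lemma D4.cont {U : ℕ → ℝ → ℝ} (h : D4 U) (k : ℕ) (hk : k < 5) :
    ContinuousOn (U k) (Ioi 0) := by
  rcases Nat.lt_or_ge k 4 with h4 | h4
  · exact cont_of_der (h.der k h4)
  · obtain rfl : k = 4 := by omega
    exact h.cont4

lemma D4.conv {U V : ℕ → ℝ → ℝ} (hU : D4 U) (hV : D4 V) : D4 (conv U V) := by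
  constructor
  · intro k hk r hr
    have u0 := hU.der 0 (by norm_num) r hr
    have u1 := hU.der 1 (by norm_num) r hr
    have u2 := hU.der 2 (by norm_num) r hr
    have u3 := hU.der 3 (by norm_num) r hr
    have v0 := hV.der 0 (by norm_num) r hr
    have v1 := hV.der 1 (by norm_num) r hr
    have v2 := hV.der 2 (by norm_num) r hr
    have v3 := hV.der 3 (by norm_num) r hr
    interval_cases k
    · refine (u0.mul v0).congr_deriv ?_
      simp only [_root_.conv]; ring
    · refine ((u0.mul v1).add (u1.mul v0)).congr_deriv ?_
      simp only [_root_.conv]; ring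
    · refine (((u0.mul v2).add ((u1.mul v1).const_mul 2)).add (u2.mul v0)).congr_deriv ?_
      simp only [_root_.conv]; ring
    · refine ((((u0.mul v3).add ((u1.mul v2).const_mul 3)).add ((u2.mul v1).const_mul 3)).add
        (u3.mul v0)).congr_deriv ?_
      simp only [_root_.conv]; ring
  · have u0 := hU.cont 0 (by norm_num)
    have u1 := hU.cont 1 (by norm_num)
    have u2 := hU.cont 2 (by norm_num)
    have u3 := hU.cont 3 (by norm_num)
    have u4 := hU.cont 4 (by norm_num)
    have v0 := hV.cont 0 (by norm_num)
    have v1 := hV.cont 1 (by norm_num)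
    have v2 := hV.cont 2 (by norm_num)
    have v3 := hV.cont 3 (by norm_num)
    have v4 := hV.cont 4 (by norm_num)
    simp only [_root_.conv]
    fun_prop

lemma conv_van {U V : ℕ → ℝ → ℝ} {R : ℝ} (hV : ∀ k, k < 5 → ∀ r, R ≤ r → V k r = 0) :
    ∀ k, k < 5 → ∀ r, R ≤ r → conv U V k r = 0 := by
  intro k hk r hr
  have v0 := hV 0 (by norm_num) r hr
  have v1 := hV 1 (by norm_num) r hr
  have v2 := hV 2 (by norm_num) r hr
  have v3 := hV 3 (by norm_num) r hr
  have v4 := hV 4 (by norm_num) r hr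
  interval_cases k <;> simp [conv, v0, v1, v2, v3, v4]

lemma D4.dL {U : ℕ → ℝ → ℝ} (h : D4 U) : ∀ r, 0 < r → HasDerivAt (LU U)
    (r * (r^2 * U 3 r + 9 * U 2 r)) r := by
  intro r hr
  refine (((hasDerivAt_pow 2 r).mul (h.der 2 (by norm_num) r hr)).add
    ((h.der 1 (by norm_num) r hr).const_mul 7)).congr_deriv ?_
  norm_num
  ring

lemma D4.dL2 {U : ℕ → ℝ → ℝ} (h : D4 U) : ∀ r, 0 < r →
    HasDerivAt (fun r => r^2 * U 3 r + 9 * U 2 r) (r * (r^2 * U 4 r + 11 * U 3 r)) r := by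
  intro r hr
  refine (((hasDerivAt_pow 2 r).mul (h.der 3 (by norm_num) r hr)).add
    ((h.der 2 (by norm_num) r hr).const_mul 9)).congr_deriv ?_
  norm_num
  ring

lemma hasFDerivAt_nrm {x : E7} (hx : x ≠ 0) :
    HasFDerivAt (fun y : E7 => ‖y‖) (‖x‖⁻¹ • (innerSL ℝ x : E7 →L[ℝ] ℝ)) x := by
  have h1 := (hasStrictFDerivAt_norm_sq x).hasFDerivAt.sqrt
    (by have := norm_pos_iff.2 hx; positivity)
  have e : (fun y : E7 => √(‖y‖^2)) = fun y => ‖y‖ := by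
    ext y; exact Real.sqrt_sq (norm_nonneg y)
  rw [e, Real.sqrt_sq (norm_nonneg x)] at h1
  refine h1.congr_fderiv ?_
  ext y
  simp
  have := norm_pos_iff.2 hx
  field_simp

lemma lap_radial {g : E7 → ℝ} {G0 G1 G2 : ℝ → ℝ} (hg : ∀ x, x ≠ 0 → g x = G0 ‖x‖)
    (d0 : ∀ r, 0 < r → HasDerivAt G0 (r * G1 r) r) (d1 : ∀ r, 0 < r → HasDerivAt G1 (r * G2 r) r)
    {x : E7} (hx : x ≠ 0) : lap g x = ‖x‖^2 * G2 ‖x‖ + 7 * G1 ‖x‖ := by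
  have comp : ∀ (H H1 : ℝ → ℝ), (∀ r, 0 < r → HasDerivAt H (r * H1 r) r) → ∀ y : E7, y ≠ 0 →
      HasFDerivAt (fun y : E7 => H ‖y‖) (H1 ‖y‖ • (innerSL ℝ y : E7 →L[ℝ] ℝ)) y := by
    intro H H1 hd y hy
    have hp := norm_pos_iff.2 hy
    refine ((hd ‖y‖ hp).comp_hasFDerivAt y (hasFDerivAt_nrm hy)).congr_fderiv ?_
    ext z
    simp
    field_simp
  have ev : ∀ y : E7, y ≠ 0 → ∀ᶠ z in nhds y, z ≠ 0 := fun y hy =>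
    isOpen_ne.mem_nhds hy
  have f1 : ∀ y : E7, y ≠ 0 → fderiv ℝ g y = G1 ‖y‖ • (innerSL ℝ y : E7 →L[ℝ] ℝ) := by
    intro y hy
    refine HasFDerivAt.fderiv ((comp G0 G1 d0 y hy).congr_of_eventuallyEq ?_)
    filter_upwards [ev y hy] with z hz using hg z hz
  obtain ⟨J, hJ⟩ : ∃ J : E7 →L[ℝ] E7 →L[ℝ] ℝ, ∀ y, J y = innerSL ℝ y :=
    ⟨innerSL ℝ, fun _ => rfl⟩
  have f2 : HasFDerivAt (fderiv ℝ g) (G1 ‖x‖ • J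
      + (G2 ‖x‖ • (innerSL ℝ x : E7 →L[ℝ] ℝ)).smulRight (innerSL ℝ x : E7 →L[ℝ] ℝ)) x := by
    have h1 := (comp G1 G2 d1 x hx).smul (J.hasFDerivAt (x := x))
    rw [hJ] at h1
    refine h1.congr_of_eventuallyEq ?_
    filter_upwards [ev x hx] with z hz
    rw [f1 z hz, ← hJ]; rfl
  unfold lap
  simp only [iteratedFDeriv_two_apply, f2.fderiv]
  have hn : ‖x‖^2 = ∑ i, (x i)^2 := by
    rw [EuclideanSpace.norm_sq_eq]; simp
  simp [hn, hJ, Finset.sum_add_distrib, Finset.sum_mul]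
  rw [add_comm]
  congr 1
  apply Finset.sum_congr rfl
  intro i _
  have hi : inner ℝ x (EuclideanSpace.single i 1) = x i := by
    rw [EuclideanSpace.inner_single_right]; simp
  rw [hi]
  ring

lemma lap_prof {g : E7 → ℝ} {U : ℕ → ℝ → ℝ} (h : D4 U) (hg : ∀ x, x ≠ 0 → g x = U 0 ‖x‖) :
    (∀ x, x ≠ 0 → lap g x = LU U ‖x‖) ∧ (∀ x, x ≠ 0 → lap (lap g) x = LLU U ‖x‖) := by
  have h1 : ∀ x, x ≠ 0 → lap g x = LU U ‖x‖ := fun x hx =>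
    lap_radial hg (h.der 0 (by norm_num)) (h.der 1 (by norm_num)) hx
  refine ⟨h1, fun x hx => ?_⟩
  rw [lap_radial h1 h.dL h.dL2 hx]
  unfold LLU; ring

def cS : ℝ := 7 * volume.real (Metric.ball (0:E7) 1)

lemma cS_pos : 0 < cS := by
  unfold cS
  have : 0 < volume.real (Metric.ball (0:E7) 1) :=
    ENNReal.toReal_pos (Metric.measure_ball_pos volume _ one_pos).ne' measure_ball_lt_top.ne
  linarith

lemma int_polar (g : ℝ → ℝ) :
    ∫ x : E7, g ‖x‖ = cS * ∫ r in Ioi (0:ℝ), r^6 * g r := by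
  have := integral_fun_norm_addHaar (volume : Measure E7) g
  simp at this
  rw [this]; unfold cS; ring

lemma ae_ne : ∀ᵐ x : E7, x ≠ 0 := by
  have : volume ({0} : Set E7) = 0 := measure_singleton 0
  exact compl_mem_ae_iff.2 this

lemma polar_down {f : E7 → ℝ} {g : ℝ → ℝ} (hf : Integrable f) (hfg : ∀ x, x ≠ 0 → f x = g ‖x‖)
    (g0 : ∀ r, 0 < r → 0 ≤ g r) {ε R : ℝ} (hε : 0 < ε) (hR : ε ≤ R) :
    cS * ∫ r in ε..R, r^6 * g r ≤ ∫ x, f x := by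
  have hae : f =ᵐ[volume] fun x => g ‖x‖ := by
    filter_upwards [ae_ne] with x hx using hfg x hx
  rw [integral_congr_ae hae, int_polar]
  refine mul_le_mul_of_nonneg_left ?_ cS_pos.le
  have hi := (integrable_fun_norm_addHaar (volume : Measure E7)).1 (hf.congr hae)
  simp at hi
  rw [intervalIntegral.integral_of_le hR]
  refine setIntegral_mono_set hi ?_ ?_
  · filter_upwards [ae_restrict_mem measurableSet_Ioi] with r hr
    have := g0 r hr
    have hr' : 0 < r := hr
    positivity
  · refine Filter.Eventually.of_forall (fun r hr => ?_)
    exact hε.trans hr.1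

lemma polar_up {f : E7 → ℝ} {g : ℝ → ℝ} (hfg : ∀ x, x ≠ 0 → f x = g ‖x‖)
    (gc : ContinuousOn g (Ioi 0)) (g0 : ∀ r, 0 < r → 0 ≤ g r) {R K : ℝ} (hR0 : 0 < R)
    (gv : ∀ r, R ≤ r → g r = 0)
    (hK : ∀ ε, 0 < ε → ε ≤ R → ∫ r in ε..R, r^6 * g r ≤ K) :
    ∫⁻ x, ENNReal.ofReal (f x) ≤ ENNReal.ofReal (cS * K) := by
  have hc : ContinuousOn (fun r => r^6 * g r) (Ioi 0) := by fun_prop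
  have n0 : ∀ r, 0 < r → 0 ≤ r^6 * g r := fun r hr => mul_nonneg (by positivity) (g0 r hr)
  have i1 : IntegrableOn (fun r => r^6 * g r) (Ioc 0 R) := by
    refine integrableOn_Ioc_of_intervalIntegral_norm_bounded_left
      (a := fun n : ℕ => R / (n + 1)) (I := K) (l := Filter.atTop) ?_ ?_ ?_
    · intro n
      have h1 : 0 < R / ((n:ℝ) + 1) := by positivity
      refine ((hc.mono ?_).integrableOn_Icc (a := R / ((n:ℝ) + 1)) (b := R)).mono_set Ioc_subset_Icc_self
      intro x hx; exact h1.trans_le hx.1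
    · have := tendsto_one_div_add_atTop_nhds_zero_nat (𝕜 := ℝ)
      have h2 := this.const_mul R
      simpa [div_eq_mul_inv] using h2
    · refine Filter.Eventually.of_forall (fun n => ?_)
      have h1 : 0 < R / ((n:ℝ) + 1) := by positivity
      have h2 : R / ((n:ℝ) + 1) ≤ R := div_le_self hR0.le (by linarith [(Nat.cast_nonneg n : (0:ℝ) ≤ n)])
      have h3 := hK _ h1 h2
      rw [intervalIntegral.integral_of_le h2] at h3
      refine le_trans (le_of_eq ?_) h3
      refine setIntegral_congr_fun measurableSet_Ioc (fun x hx => ?_)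
      exact Real.norm_of_nonneg (n0 x (h1.trans hx.1))
  have i2 : IntegrableOn (fun r => r^6 * g r) (Ioi R) := by
    refine IntegrableOn.congr_fun (f := fun _ => (0:ℝ)) (by simp) ?_ measurableSet_Ioi
    intro x hx
    simp [gv x (le_of_lt hx)]
  have i3 : IntegrableOn (fun r => r^6 * g r) (Ioi 0) := by
    rw [← Ioc_union_Ioi_eq_Ioi hR0.le]; exact i1.union i2
  have eq1 : ∫ r in Ioi (0:ℝ), r^6 * g r = ∫ r in (0:ℝ)..R, r^6 * g r := by
    rw [← Ioc_union_Ioi_eq_Ioi hR0.le, setIntegral_union (Ioc_disjoint_Ioi le_rfl)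
      measurableSet_Ioi i1 i2, intervalIntegral.integral_of_le hR0.le]
    have : ∫ r in Ioi R, r^6 * g r = 0 := by
      rw [setIntegral_congr_fun measurableSet_Ioi (g := fun _ => (0:ℝ))]
      · simp
      · intro x hx
        simp [gv x (le_of_lt hx)]
    rw [this, add_zero]
  have le1 : ∫ r in (0:ℝ)..R, r^6 * g r ≤ K := by
    have hi : IntegrableOn (fun r => r^6 * g r) (uIcc 0 R) := by
      rw [uIcc_of_le hR0.le, integrableOn_Icc_iff_integrableOn_Ioc]; exact i1
    have hcc := intervalIntegral.continuousOn_primitive_interval_left hi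
    rw [uIcc_of_le hR0.le] at hcc
    have ht := (hcc 0 (left_mem_Icc.2 hR0.le)).mono_left
      (nhdsWithin_mono 0 (Ioc_subset_Icc_self : Ioc 0 R ⊆ Icc 0 R))
    have : (nhdsWithin (0:ℝ) (Ioc 0 R)).NeBot := by
      rw [nhdsWithin_Ioc_eq_nhdsGT hR0]; infer_instance
    refine le_of_tendsto ht ?_
    filter_upwards [self_mem_nhdsWithin] with ε hε using hK ε hε.1 hε.2
  have hae : f =ᵐ[volume] fun x => g ‖x‖ := by
    filter_upwards [ae_ne] with x hx using hfg x hx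
  have hgInt : Integrable (fun x : E7 => g ‖x‖) := by
    refine (integrable_fun_norm_addHaar (volume : Measure E7)).2 ?_
    simpa using i3
  have hgInt' := hgInt.congr hae.symm
  rw [← ofReal_integral_eq_lintegral_ofReal hgInt' ?_]
  · apply ENNReal.ofReal_le_ofReal
    rw [integral_congr_ae hae, int_polar, eq1]
    exact mul_le_mul_of_nonneg_left le1 cS_pos.le
  · filter_upwards [ae_ne] with x hx
    rw [hfg x hx]; exact g0 _ (norm_pos_iff.2 hx)



def e0 : E7 := EuclideanSpace.single 0 1

def prof0 (u : E7 → ℝ) (r : ℝ) : ℝ := u (r • e0)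

def prof (u : E7 → ℝ) : ℕ → ℝ → ℝ
  | 0 => prof0 u
  | 1 => fun r => iteratedDeriv 1 (prof0 u) r / r
  | 2 => fun r => (r * iteratedDeriv 2 (prof0 u) r - iteratedDeriv 1 (prof0 u) r) / r^3
  | 3 => fun r => (r^2 * iteratedDeriv 3 (prof0 u) r - 3 * r * iteratedDeriv 2 (prof0 u) r
      + 3 * iteratedDeriv 1 (prof0 u) r) / r^5
  | 4 => fun r => (r^3 * iteratedDeriv 4 (prof0 u) r - 6 * r^2 * iteratedDeriv 3 (prof0 u) r
      + 15 * r * iteratedDeriv 2 (prof0 u) r - 15 * iteratedDeriv 1 (prof0 u) r) / r^7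
  | _ => fun _ => 0

lemma norm_e0 : ‖e0‖ = 1 := by simp [e0]

lemma prof_eq {u : E7 → ℝ} (hr : IsRadial u) (x : E7) : u x = prof u 0 ‖x‖ := by
  apply hr
  rw [norm_smul, norm_e0]
  simp

lemma prof0_smooth {u : E7 → ℝ} (hu : ContDiff ℝ (⊤ : ℕ∞) u) : ContDiff ℝ (⊤ : ℕ∞) (prof0 u) := by
  unfold prof0
  fun_prop

lemma iter_der {u : E7 → ℝ} (hu : ContDiff ℝ (⊤ : ℕ∞) u) (k : ℕ) (r : ℝ) :
    HasDerivAt (iteratedDeriv k (prof0 u)) (iteratedDeriv (k+1) (prof0 u) r) r := by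
  rw [iteratedDeriv_succ]
  refine DifferentiableAt.hasDerivAt ?_
  exact ((prof0_smooth hu).differentiable_iteratedDeriv k (by exact_mod_cast WithTop.coe_lt_top _)) r

lemma prof_d4 {u : E7 → ℝ} (hu : ContDiff ℝ (⊤ : ℕ∞) u) : D4 (prof u) := by
  constructor
  · intro k hk r hr
    have h0 := iter_der hu 0 r
    have h1 := iter_der hu 1 r
    have h2 := iter_der hu 2 r
    have h3 := iter_der hu 3 r
    have hr0 := hr.ne'
    have p : ∀ n : ℕ, HasDerivAt (fun x : ℝ => x^n) (n * r^(n-1)) r := fun n => hasDerivAt_pow n r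
    interval_cases k
    · rw [iteratedDeriv_zero] at h0
      refine h0.congr_deriv ?_
      simp only [prof]
      field_simp
    · refine (h1.div (hasDerivAt_id r) hr0).congr_deriv ?_
      simp only [prof, id]
      field_simp
    · refine ((((hasDerivAt_id r).mul h2).sub h1).div (p 3) (pow_ne_zero 3 hr0)).congr_deriv ?_
      simp only [prof, id]
      norm_num
      field_simp
      ring
    · refine ((((p 2).mul h3).sub ((((hasDerivAt_id r).const_mul 3)).mul h2)).add
        (h1.const_mul 3)|>.div (p 5) (pow_ne_zero 5 hr0)).congr_deriv ?_
      simp only [prof, id]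
      norm_num
      field_simp
      ring
  · have c : ∀ k, ContinuousOn (iteratedDeriv k (prof0 u)) (Ioi 0) := fun k r _ =>
      (iter_der hu k r).continuousAt.continuousWithinAt
    have c1 := c 1
    have c2 := c 2
    have c3 := c 3
    have c4 := c 4
    simp only [prof]
    refine ContinuousOn.div (by fun_prop) (by fun_prop) ?_
    intro r hr
    exact pow_ne_zero _ (ne_of_gt hr)

lemma prof_van {u : E7 → ℝ} (hc : HasCompactSupport u) :
    ∃ R0 : ℝ, 0 < R0 ∧ ∀ k, k < 5 → ∀ r, R0 ≤ r → prof u k r = 0 := by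
  obtain ⟨R, hR⟩ := hc.isCompact.isBounded.subset_closedBall 0
  refine ⟨max R 0 + 1, by positivity, ?_⟩
  have z : ∀ r, max R 0 < r → prof0 u r = 0 := by
    intro r hr
    by_contra h
    have h1 := hR (subset_tsupport u (show r • e0 ∈ Function.support u from h))
    rw [mem_closedBall_zero_iff, norm_smul, norm_e0, mul_one] at h1
    have h2 := le_max_left R 0
    have h3 := le_abs_self r
    rw [Real.norm_eq_abs] at h1
    linarith
  intro k hk r hr
  have it : ∀ j, iteratedDeriv j (prof0 u) r = 0 := by
    intro j
    have : prof0 u =ᶠ[nhds r] fun _ => (0:ℝ) := by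
      filter_upwards [Ioi_mem_nhds (show max R 0 < r by linarith)] with x hx using z x hx
    rw [this.iteratedDeriv_eq]
    simp
  interval_cases k <;> simp [prof, it]
  exact z r (by linarith)

lemma lap_smooth {u : E7 → ℝ} (hu : ContDiff ℝ (⊤ : ℕ∞) u) : ContDiff ℝ (⊤ : ℕ∞) (lap u) := by
  unfold lap
  have : ContDiff ℝ (⊤ : ℕ∞) (iteratedFDeriv ℝ 2 u) :=
    hu.iteratedFDeriv_right (by exact_mod_cast le_rfl)
  refine ContDiff.sum (fun i _ => ?_)
  exact (ContinuousMultilinearMap.apply ℝ (fun _ : Fin 2 => E7) ℝ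
    ![EuclideanSpace.single i 1, EuclideanSpace.single i 1]).contDiff.comp this

lemma lap_cs {u : E7 → ℝ} (hc : HasCompactSupport u) : HasCompactSupport (lap u) := by
  have := hc.iteratedFDeriv (𝕜 := ℝ) 2
  refine this.mono ?_
  intro x hx
  contrapose! hx
  simp only [Function.mem_support, not_not] at hx ⊢
  simp [lap, hx]

lemma sq_int {f : E7 → ℝ} (hf : ContDiff ℝ (⊤ : ℕ∞) f) (hc : HasCompactSupport f) :
    Integrable (fun x => (f x)^2) := by
  have h1 : Continuous (fun x => (f x)^2) := hf.continuous.pow 2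
  refine h1.integrable_of_hasCompactSupport ?_
  refine hc.mono ?_
  intro x hx h
  apply hx
  simp [h]

lemma Hn_eq {u : E7 → ℝ} (hu : ContDiff ℝ (⊤ : ℕ∞) u) (hc : HasCompactSupport u) :
    HnormSq u = ENNReal.ofReal ((∫ x, (lap u x)^2) + ∫ x, (lap (lap u) x)^2) := by
  unfold HnormSq
  rw [ENNReal.ofReal_add (integral_nonneg fun x => sq_nonneg _)
    (integral_nonneg fun x => sq_nonneg _),
    ofReal_integral_eq_lintegral_ofReal (sq_int (lap_smooth hu) (lap_cs hc))
      (Filter.Eventually.of_forall fun x => sq_nonneg _),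
    ofReal_integral_eq_lintegral_ofReal (sq_int (lap_smooth (lap_smooth hu)) (lap_cs (lap_cs hc)))
      (Filter.Eventually.of_forall fun x => sq_nonneg _)]

lemma bdry {h : ℝ → ℝ} {U1 : ℝ → ℝ} (hc : Continuous h) (he : ∀ r, 0 < r → U1 r = r * (h r)^2) :
    Filter.Tendsto U1 (nhdsWithin 0 (Ioi 0)) (nhds 0) := by
  have h1 : Continuous (fun r : ℝ => r * (h r)^2) := by fun_prop
  have h2 := (h1.tendsto 0).mono_left (nhdsWithin_le_nhds (s := Ioi 0))
  simp only [zero_mul] at h2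
  refine h2.congr' ?_
  filter_upwards [self_mem_nhdsWithin] with r hr
  exact (he r hr).symm

lemma exists_En {u : E7 → ℝ} (hu : ContDiff ℝ (⊤ : ℕ∞) u) (hc : HasCompactSupport u)
    (hr : IsRadial u) :
    ∃ E : ℝ, 0 ≤ E ∧ HnormSq u = ENNReal.ofReal (cS * E) ∧
      ∃ R0 : ℝ, 0 < R0 ∧ ∀ R, R0 ≤ R → En (prof u) R E := by
  obtain ⟨R0, hR0, hv⟩ := prof_van hc
  set I := (∫ x, (lap u x)^2) + ∫ x, (lap (lap u) x)^2 with hI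
  have n1 : 0 ≤ ∫ x, (lap u x)^2 := integral_nonneg fun x => sq_nonneg _
  have n2 : 0 ≤ ∫ x, (lap (lap u) x)^2 := integral_nonneg fun x => sq_nonneg _
  have cp := cS_pos
  have d4 := prof_d4 hu
  obtain ⟨l1, l2⟩ := lap_prof d4 (fun x _ => prof_eq hr x)
  have cit : ∀ k, Continuous (iteratedDeriv k (prof0 u)) := fun k =>
    continuous_iff_continuousAt.2 fun r => (iter_der hu k r).continuousAt
  have c1 := cit 1
  have c2 := cit 2
  have c3 := cit 3
  refine ⟨I / cS, by positivity, ?_, R0, hR0, fun R hR => ?_⟩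
  · rw [Hn_eq hu hc]; congr 1; field_simp; exact hI.symm
  · constructor
    · exact ⟨d4.der, d4.cont4, fun k hk r hr => hv k hk r (hR.trans hr)⟩
    · refine bdry (h := fun r => r^2 * iteratedDeriv 1 (prof0 u) r) (by fun_prop) ?_
      intro r hr
      simp only [prof]; field_simp
    · refine bdry (h := fun r => r * iteratedDeriv 2 (prof0 u) r - iteratedDeriv 1 (prof0 u) r)
        (by fun_prop) ?_
      intro r hr
      simp only [prof]; field_simp
    · refine bdry (h := fun r => r^2 * iteratedDeriv 3 (prof0 u) r
        + 6 * r * iteratedDeriv 2 (prof0 u) r - 6 * iteratedDeriv 1 (prof0 u) r) (by fun_prop) ?_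
      intro r hr
      simp only [prof]; field_simp; ring
    · intro ε hε hεR
      rw [le_div_iff₀ cp]
      have := polar_down (g := fun r => (LU (prof u) r)^2) (sq_int (lap_smooth hu) (lap_cs hc))
        (fun x hx => by rw [l1 x hx]) (fun r _ => sq_nonneg _) hε hεR
      linarith
    · intro ε hε hεR
      rw [le_div_iff₀ cp]
      have := polar_down (g := fun r => (LLU (prof u) r)^2)
        (sq_int (lap_smooth (lap_smooth hu)) (lap_cs (lap_cs hc)))
        (fun x hx => by rw [l2 x hx]) (fun r _ => sq_nonneg _) hε hεR
      linarith



lemma a1_pos : 0 < a1 := by unfold a1; positivity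
lemma a2_pos : 0 < a2 := by
  unfold a2
  have h : √6 < 18 / 7 := by
    rw [Real.sqrt_lt' (by norm_num)]; norm_num
  linarith

def qf (r : ℝ) : ℝ := (a1 * r^2 + a2)⁻¹

lemma qf_den (r : ℝ) : 0 < a1 * r^2 + a2 := by
  have := a1_pos; have := a2_pos; positivity

lemma qf_der (r : ℝ) : HasDerivAt qf (-(2 * a1 * r) * (qf r)^2) r := by
  have h := (((hasDerivAt_pow 2 r).const_mul a1).add_const a2).inv (qf_den r).ne'
  refine h.congr_deriv ?_
  unfold qf
  have := (qf_den r).ne'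
  norm_num
  field_simp

def F1 : ℕ → ℝ → ℝ
  | 0 => fun r => f1 r
  | 1 => fun r => (-9 * a2 / a1) * (-2 * a1) * (qf r)^2
  | 2 => fun r => (-9 * a2 / a1) * (8 * a1^2) * (qf r)^3
  | 3 => fun r => (-9 * a2 / a1) * (-48 * a1^3) * (qf r)^4
  | 4 => fun r => (-9 * a2 / a1) * (384 * a1^4) * (qf r)^5
  | _ => fun _ => 0

lemma f1_eq (r : ℝ) : f1 r = -9 * (1 - 1 / a1) + (-9 * a2 / a1) * qf r := by
  have hq : (a1 * r^2 + a2) * qf r = 1 := mul_inv_cancel₀ (qf_den r).ne'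
  have ha := a1_pos.ne'
  have h1 : 1 / (a1 * r^2 + a2) = qf r := one_div _
  have h2 : r^2 * qf r = 1 / a1 - a2 / a1 * qf r := by
    field_simp
    linear_combination hq
  unfold f1 Wprof
  rw [h1]
  linear_combination 9 * h2

lemma F1_d4 : D4 F1 := by
  have ha := a1_pos.ne'
  constructor
  · intro k hk r hr
    have q := qf_der r
    interval_cases k
    · have e : F1 0 = fun r => -9 * (1 - 1 / a1) + (-9 * a2 / a1) * qf r := by
        ext r; exact f1_eq r
      rw [e]
      refine ((q.const_mul (-9 * a2 / a1)).const_add _).congr_deriv ?_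
      simp only [F1]; ring
    · refine ((q.pow 2).const_mul _).congr_deriv ?_
      simp only [F1]; norm_num; ring
    · refine ((q.pow 3).const_mul _).congr_deriv ?_
      simp only [F1]; norm_num; ring
    · refine ((q.pow 4).const_mul _).congr_deriv ?_
      simp only [F1]; norm_num; ring
  · have : Continuous qf := continuous_iff_continuousAt.2 fun r => (qf_der r).continuousAt
    simp only [F1]
    fun_prop

lemma F1_bd : ∃ K : ℝ, 0 < K ∧ ∀ r, 0 < r →
    FB r (F1 0 r) (F1 1 r) (F1 2 r) (F1 3 r) (F1 4 r) K := by
  set B := 1 + 1 / a1 + 1 / a2 with hB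
  have ha1 := a1_pos
  have ha2 := a2_pos
  have hp1 : 0 < 1 / a1 := by positivity
  have hp2 : 0 < 1 / a2 := by positivity
  have hB0 : 0 < B := by positivity
  set κ := -9 * a2 / a1 with hκ
  set K := |-9 * (1 - 1 / a1)| + |κ| * B + |κ * (-2 * a1)| * B^2 + |κ * (8 * a1^2)| * B^3
    + |κ * (-48 * a1^3)| * B^4 + |κ * (384 * a1^4)| * B^5 + 1 with hK
  have k0 : 0 ≤ |-9 * (1 - 1 / a1)| := by positivity
  have k1 : 0 ≤ |κ| * B := by positivity
  have k2 : 0 ≤ |κ * (-2 * a1)| * B^2 := by positivity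
  have k3 : 0 ≤ |κ * (8 * a1^2)| * B^3 := by positivity
  have k4 : 0 ≤ |κ * (-48 * a1^3)| * B^4 := by positivity
  have k5 : 0 ≤ |κ * (384 * a1^4)| * B^5 := by positivity
  refine ⟨K, by positivity, fun r hr => ?_⟩
  have q0 : 0 < qf r := inv_pos.2 (qf_den r)
  have q1 : qf r ≤ B := by
    have : qf r ≤ 1 / a2 := by
      unfold qf
      rw [← one_div]
      apply one_div_le_one_div_of_le ha2
      have : 0 ≤ a1 * r^2 := by positivity
      linarith
    linarith
  have q2 : r^2 * qf r ≤ B := by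
    have : r^2 * qf r ≤ 1 / a1 := by
      unfold qf
      rw [← div_eq_mul_inv, div_le_div_iff₀ (qf_den r) ha1]
      linarith
    linarith
  have m : ∀ i j : ℕ, (r^2 * qf r)^i * (qf r)^j ≤ B^(i+j) := by
    intro i j
    rw [pow_add]
    have h1 : (r^2 * qf r)^i ≤ B^i := pow_le_pow_left₀ (by positivity) q2 i
    have h2 : (qf r)^j ≤ B^j := pow_le_pow_left₀ q0.le q1 j
    exact mul_le_mul h1 h2 (by positivity) (by positivity)
  have g : ∀ (c : ℝ) (i j n : ℕ), n = i + j → r^(2*i) * |c * (qf r)^n| ≤ |c| * B^n := by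
    intro c i j n hn
    subst hn
    rw [abs_mul, abs_of_pos (by positivity : 0 < (qf r)^(i+j))]
    calc r^(2*i) * (|c| * (qf r)^(i+j)) = |c| * ((r^2 * qf r)^i * (qf r)^j) := by ring
      _ ≤ _ := mul_le_mul_of_nonneg_left (m i j) (abs_nonneg c)
  constructor
  · have h1 : F1 0 r = -9 * (1 - 1 / a1) + κ * qf r := f1_eq r
    have h2 := g κ 0 1 1 rfl
    simp only [mul_zero, pow_zero, one_mul, pow_one] at h2
    rw [h1]
    have := abs_add_le (-9 * (1 - 1 / a1)) (κ * qf r)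
    linarith
  · have := g (κ * (-2 * a1)) 0 2 2 rfl
    simp only [mul_zero, pow_zero, one_mul] at this
    exact this.trans (by linarith)
  · exact (g (κ * (-2 * a1)) 1 1 2 rfl).trans (by linarith)
  · exact (g (κ * (8 * a1^2)) 1 2 3 rfl).trans (by linarith)
  · exact (g (κ * (8 * a1^2)) 2 1 3 rfl).trans (by linarith)
  · have := g (κ * (8 * a1^2)) 0 3 3 rfl
    simp only [mul_zero, pow_zero, one_mul] at this
    exact this.trans (by linarith)
  · exact (g (κ * (-48 * a1^3)) 1 3 4 rfl).trans (by linarith)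
  · exact (g (κ * (-48 * a1^3)) 2 2 4 rfl).trans (by linarith)
  · exact (g (κ * (384 * a1^4)) 3 2 5 rfl).trans (by linarith)

def F2 : ℕ → ℝ → ℝ
  | 0 => fun r => -3 * r^2
  | 1 => fun _ => -6
  | _ => fun _ => 0

lemma F2_d4 : D4 F2 := by
  constructor
  · intro k hk r hr
    interval_cases k
    · refine ((hasDerivAt_pow 2 r).const_mul (-3)).congr_deriv ?_
      simp only [F2]; norm_num; ring
    · exact (hasDerivAt_const r (-6:ℝ)).congr_deriv (by simp [F2])
    · exact (hasDerivAt_const r (0:ℝ)).congr_deriv (by simp [F2])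
    · exact (hasDerivAt_const r (0:ℝ)).congr_deriv (by simp [F2])
  · simp only [F2]; fun_prop

lemma LU_S1 (U : ℕ → ℝ → ℝ) (r : ℝ) : LU U r = S1 r (U 1 r) (U 2 r) := rfl
lemma LLU_S2 (U : ℕ → ℝ → ℝ) (r : ℝ) : LLU U r = S2 r (U 2 r) (U 3 r) (U 4 r) := rfl

/-- from a pointwise bound of the profile to a bound of the norm -/
lemma Hn_le {p : E7 → ℝ} {H : ℕ → ℝ → ℝ} {R K : ℝ} (hR : 0 < R) (hd : D4 H)
    (hv : ∀ k, k < 5 → ∀ r, R ≤ r → H k r = 0)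
    (hp : ∀ x, x ≠ 0 → p x = H 0 ‖x‖) {G : ℝ → ℝ} (Gc : ContinuousOn G (Ioi 0))
    (h1 : ∀ r, 0 < r → (LU H r)^2 ≤ G r) (h2 : ∀ r, 0 < r → (LLU H r)^2 ≤ G r)
    (hG : ∀ ε, 0 < ε → ε ≤ R → ∫ r in ε..R, r^6 * G r ≤ K) :
    HnormSq p ≤ ENNReal.ofReal (2 * (cS * K)) := by
  have c1 := hd.cont 1 (by norm_num)
  have c2 := hd.cont 2 (by norm_num)
  have c3 := hd.cont 3 (by norm_num)
  have c4 := hd.cont 4 (by norm_num)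
  obtain ⟨l1, l2⟩ := lap_prof hd hp
  have v1 := hv 1 (by norm_num)
  have v2 := hv 2 (by norm_num)
  have v3 := hv 3 (by norm_num)
  have v4 := hv 4 (by norm_num)
  have cL : ContinuousOn (fun r => (LU H r)^2) (Ioi 0) := by unfold LU; fun_prop
  have cLL : ContinuousOn (fun r => (LLU H r)^2) (Ioi 0) := by unfold LLU; fun_prop
  have K0 : 0 ≤ K := by
    refine le_trans ?_ (hG R hR le_rfl)
    simp
  have gen : ∀ g : ℝ → ℝ, ContinuousOn g (Ioi 0) → (∀ r, 0 < r → g r ≤ G r) →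
      ∀ ε, 0 < ε → ε ≤ R → ∫ r in ε..R, r^6 * g r ≤ K := by
    intro g gc hle ε hε hεR
    refine le_trans ?_ (hG ε hε hεR)
    refine intervalIntegral.integral_mono_on hεR (ii_of_cont hε hεR (by fun_prop))
      (ii_of_cont hε hεR (by fun_prop)) ?_
    intro r hr
    have hr0 := hε.trans_le hr.1
    exact mul_le_mul_of_nonneg_left (hle r hr0) (by positivity)
  have A := polar_up (f := fun x => (lap p x)^2) (g := fun r => (LU H r)^2)
    (fun x hx => by simp only [l1 x hx]) cL (fun r _ => sq_nonneg _) hR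
    (fun r hr => by simp [LU, v1 r hr, v2 r hr]) (gen _ cL h1)
  have B := polar_up (f := fun x => (lap (lap p) x)^2) (g := fun r => (LLU H r)^2)
    (fun x hx => by simp only [l2 x hx]) cLL (fun r _ => sq_nonneg _) hR
    (fun r hr => by simp [LLU, v2 r hr, v3 r hr, v4 r hr]) (gen _ cLL h2)
  have cK : 0 ≤ cS * K := mul_nonneg cS_pos.le K0
  unfold HnormSq
  rw [two_mul, ENNReal.ofReal_add cK cK]
  exact add_le_add A B

lemma Qd_nonneg (U : ℕ → ℝ → ℝ) (r : ℝ) : 0 ≤ Qd U r := by unfold Qd; positivity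

lemma sq_le_of_abs {x A : ℝ} (h : |x| ≤ A) : x^2 ≤ A^2 := by
  rw [← sq_abs]; exact pow_le_pow_left₀ (abs_nonneg x) h 2

lemma int_comb2 {g1 g2 : ℝ → ℝ} {R c1 c2 b1 b2 : ℝ} (h1 : ContinuousOn g1 (Ioi 0))
    (h2 : ContinuousOn g2 (Ioi 0)) (n1 : 0 ≤ c1) (n2 : 0 ≤ c2)
    (i1 : ∀ ε, 0 < ε → ε ≤ R → ∫ r in ε..R, r^6 * g1 r ≤ b1)
    (i2 : ∀ ε, 0 < ε → ε ≤ R → ∫ r in ε..R, r^6 * g2 r ≤ b2) :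
    ∀ ε, 0 < ε → ε ≤ R → ∫ r in ε..R, r^6 * (c1 * g1 r + c2 * g2 r) ≤ c1 * b1 + c2 * b2 := by
  intro ε hε hR
  have e : (fun r => r^6 * (c1 * g1 r + c2 * g2 r))
      = fun r => c1 * (r^6 * g1 r) + c2 * (r^6 * g2 r) := by ext r; ring
  have I1 : IntervalIntegrable (fun r => r^6 * g1 r) volume ε R := ii_of_cont hε hR (by fun_prop)
  have I2 : IntervalIntegrable (fun r => r^6 * g2 r) volume ε R := ii_of_cont hε hR (by fun_prop)
  rw [e, intervalIntegral.integral_add (I1.const_mul _) (I2.const_mul _),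
    intervalIntegral.integral_const_mul, intervalIntegral.integral_const_mul]
  exact add_le_add (mul_le_mul_of_nonneg_left (i1 ε hε hR) n1)
    (mul_le_mul_of_nonneg_left (i2 ε hε hR) n2)

lemma quad_final : ∃ C : ℝ, 0 < C ∧ ∀ (u v p : E7 → ℝ) (EU EV R : ℝ), 0 < R → 0 ≤ EU → 0 ≤ EV →
    En (prof u) R EU → En (prof v) R EV →
    (∀ x, p x = f1 ‖x‖ * (prof u 0 ‖x‖ * prof v 0 ‖x‖)) →
    HnormSq p ≤ ENNReal.ofReal (C * (EU * EV)) := by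
  obtain ⟨K, hK, hF⟩ := F1_bd
  have cp := cS_pos
  refine ⟨2 * (cS * (18 * (10000 * K)^2 * 500)), by positivity, ?_⟩
  intro u v p EU EV R hR hEU hEV hU hV hp
  set U := prof u
  set V := prof v
  have dH := F1_d4.conv (hU.pr.d4.conv hV.pr.d4)
  have cU := hU.pr.contQ
  have cV := hV.pr.contQ
  have main : ∀ r, 0 < r → (LU (conv F1 (conv U V)) r)^2
        ≤ (18 * (10000 * K)^2 * EV) * Qd U r + (18 * (10000 * K)^2 * EU) * Qd V r ∧
      (LLU (conv F1 (conv U V)) r)^2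
        ≤ (18 * (10000 * K)^2 * EV) * Qd U r + (18 * (10000 * K)^2 * EU) * Qd V r := by
    intro r hr
    have gb := GB_of hr (hU.bd hEU r hr) (hV.bd hEV r hr)
    have q := quad hr (hF r hr) gb
    have alg : (10000 * (K * (√(Qd U r) * (3 * √EV) + 3 * √EU * √(Qd V r))))^2
        ≤ (18 * (10000 * K)^2 * EV) * Qd U r + (18 * (10000 * K)^2 * EU) * Qd V r := by
      have s1 := Real.sq_sqrt (Qd_nonneg U r)
      have s2 := Real.sq_sqrt (Qd_nonneg V r)
      have s3 := Real.sq_sqrt hEU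
      have s4 := Real.sq_sqrt hEV
      have : 0 ≤ 9 * (10000 * K)^2 * (√(Qd U r) * √EV - √EU * √(Qd V r))^2 := by positivity
      calc _ = 18 * (10000 * K)^2 * ((√EV)^2) * (√(Qd U r))^2
            + 18 * (10000 * K)^2 * (√EU)^2 * (√(Qd V r))^2
            - 9 * (10000 * K)^2 * (√(Qd U r) * √EV - √EU * √(Qd V r))^2 := by ring
        _ ≤ _ := by rw [s1, s2, s3, s4]; linarith
    exact ⟨(sq_le_of_abs q.1).trans alg, (sq_le_of_abs q.2).trans alg⟩
  have := Hn_le (p := p) (K := (18 * (10000 * K)^2 * EV) * (250 * EU)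
      + (18 * (10000 * K)^2 * EU) * (250 * EV)) hR dH (conv_van (conv_van hV.pr.van))
    (fun x hx => hp x) (by fun_prop) (fun r hr => (main r hr).1) (fun r hr => (main r hr).2)
    (int_comb2 cU cV (by positivity) (by positivity) hU.i_Q hV.i_Q)
  refine this.trans (le_of_eq ?_)
  congr 1; ring

lemma cub_final : ∃ C : ℝ, 0 < C ∧ ∀ (u v w p : E7 → ℝ) (EU EV EW R : ℝ), 0 < R →
    0 ≤ EU → 0 ≤ EV → 0 ≤ EW →
    En (prof u) R EU → En (prof v) R EV → En (prof w) R EW →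
    (∀ x, p x = f2 ‖x‖ * (prof u 0 ‖x‖ * (prof v 0 ‖x‖ * prof w 0 ‖x‖))) →
    HnormSq p ≤ ENNReal.ofReal (C * (EU * EV * EW)) := by
  have cp := cS_pos
  refine ⟨2 * (cS * (243 * 100000^2 * 750)), by positivity, ?_⟩
  intro u v w p EU EV EW R hR hEU hEV hEW hU hV hW hp
  set U := prof u
  set V := prof v
  set W := prof w
  have dH := F2_d4.conv (hU.pr.d4.conv (hV.pr.d4.conv hW.pr.d4))
  have cU := hU.pr.contQ
  have cV := hV.pr.contQ
  have cW := hW.pr.contQ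
  set c : ℝ := 243 * 100000^2 with hc
  have c0 : 0 ≤ c := by positivity
  have main : ∀ r, 0 < r → (LU (conv F2 (conv U (conv V W))) r)^2
        ≤ 1 * ((c * (EV * EW)) * Qd U r + (c * (EU * EW)) * Qd V r)
          + (c * (EU * EV)) * Qd W r ∧
      (LLU (conv F2 (conv U (conv V W))) r)^2
        ≤ 1 * ((c * (EV * EW)) * Qd U r + (c * (EU * EW)) * Qd V r)
          + (c * (EU * EV)) * Qd W r := by
    intro r hr
    have gb := GB_of hr (hV.bd hEV r hr) (hW.bd hEW r hr)
    have q := cub hr (hU.bd hEU r hr) gb rfl rfl rfl rfl rfl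
    have alg : (100000 * (√(Qd U r) * (3 * √EV * (3 * √EW))
          + 3 * √EU * (√(Qd V r) * (3 * √EW) + 3 * √EV * √(Qd W r))))^2
        ≤ 1 * ((c * (EV * EW)) * Qd U r + (c * (EU * EW)) * Qd V r)
          + (c * (EU * EV)) * Qd W r := by
      have s1 := Real.sq_sqrt (Qd_nonneg U r)
      have s2 := Real.sq_sqrt (Qd_nonneg V r)
      have s3 := Real.sq_sqrt (Qd_nonneg W r)
      have s4 := Real.sq_sqrt hEU
      have s5 := Real.sq_sqrt hEV
      have s6 := Real.sq_sqrt hEW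
      have gen : ∀ x y z : ℝ, (x + y + z)^2 ≤ 3 * (x^2 + y^2 + z^2) := by
        intro x y z
        nlinarith [sq_nonneg (x - y), sq_nonneg (y - z), sq_nonneg (x - z)]
      have h := gen (√(Qd U r) * √EV * √EW) (√EU * √(Qd V r) * √EW) (√EU * √EV * √(Qd W r))
      simp only [mul_pow, s1, s2, s3, s4, s5, s6] at h
      calc _ = 81 * 100000^2 * (√(Qd U r) * √EV * √EW + √EU * √(Qd V r) * √EW
            + √EU * √EV * √(Qd W r))^2 := by ring
        _ ≤ 81 * 100000^2 * (3 * (Qd U r * EV * EW + EU * Qd V r * EW + EU * EV * Qd W r)) :=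
            mul_le_mul_of_nonneg_left h (by positivity)
        _ = _ := by rw [hc]; ring
    exact ⟨(sq_le_of_abs q.1).trans alg, (sq_le_of_abs q.2).trans alg⟩
  have := Hn_le (p := p) hR dH (conv_van (conv_van (conv_van hW.pr.van)))
    (fun x hx => hp x) (by fun_prop) (fun r hr => (main r hr).1) (fun r hr => (main r hr).2)
    (int_comb2 (by fun_prop) cW zero_le_one (by positivity)
      (int_comb2 cU cV (by positivity) (by positivity) hU.i_Q hV.i_Q) hW.i_Q)
  refine this.trans (le_of_eq ?_)
  congr 1; rw [hc]; ring

lemma Hnorm_of_eq {f : E7 → ℝ} {A : ℝ} (hA : 0 ≤ A) (h : HnormSq f = ENNReal.ofReal A) :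
    Hnorm f = ENNReal.ofReal (√A) := by
  unfold Hnorm
  rw [h, ENNReal.ofReal_rpow_of_nonneg hA (by norm_num), Real.sqrt_eq_rpow]

lemma Hnorm_of_le {f : E7 → ℝ} {A : ℝ} (hA : 0 ≤ A) (h : HnormSq f ≤ ENNReal.ofReal A) :
    Hnorm f ≤ ENNReal.ofReal (√A) := by
  unfold Hnorm
  rw [Real.sqrt_eq_rpow, ← ENNReal.ofReal_rpow_of_nonneg hA (by norm_num)]
  exact ENNReal.rpow_le_rpow h (by norm_num)

/-- There is a constant `C > 0` such that for all radial `u, v, w ∈ C_c^∞(ℝ⁷,ℝ)`,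
`‖f₁(|·|)uv‖ ≤ C‖u‖‖v‖` and `‖f₂(|·|)uvw‖ ≤ C‖u‖‖v‖‖w‖`. -/
theorem stmt16 :
    ∃ C : ℝ, 0 < C ∧ ∀ u v w : E7 → ℝ,
      ContDiff ℝ (⊤ : ℕ∞) u → HasCompactSupport u → IsRadial u →
      ContDiff ℝ (⊤ : ℕ∞) v → HasCompactSupport v → IsRadial v →
      ContDiff ℝ (⊤ : ℕ∞) w → HasCompactSupport w → IsRadial w →
      Hnorm (fun x => f1 ‖x‖ * u x * v x) ≤ ENNReal.ofReal C * Hnorm u * Hnorm v ∧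
      Hnorm (fun x => f2 ‖x‖ * u x * v x * w x)
        ≤ ENNReal.ofReal C * Hnorm u * Hnorm v * Hnorm w := by
  obtain ⟨C1, hC1, H1⟩ := quad_final
  obtain ⟨C2, hC2, H2⟩ := cub_final
  have hS := cS_pos
  refine ⟨√(C1 / cS^2) + √(C2 / cS^3), by positivity, ?_⟩
  intro u v w hu hcu hru hv hcv hrv hw hcw hrw
  obtain ⟨EU, hEU, nU, RU, hRU, eU⟩ := exists_En hu hcu hru
  obtain ⟨EV, hEV, nV, RV, hRV, eV⟩ := exists_En hv hcv hrv
  obtain ⟨EW, hEW, nW, RW, hRW, eW⟩ := exists_En hw hcw hrw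
  have eU := eU (max RU (max RV RW)) (le_max_left _ _)
  have eV := eV (max RU (max RV RW)) (le_trans (le_max_left _ _) (le_max_right _ _))
  have eW := eW (max RU (max RV RW)) (le_trans (le_max_right _ _) (le_max_right _ _))
  have hR : 0 < max RU (max RV RW) := lt_of_lt_of_le hRU (le_max_left _ _)
  have mU := Hnorm_of_eq (by positivity) nU
  have mV := Hnorm_of_eq (by positivity) nV
  have mW := Hnorm_of_eq (by positivity) nW
  have sU := Real.sqrt_nonneg (cS * EU)
  have sV := Real.sqrt_nonneg (cS * EV)
  have sW := Real.sqrt_nonneg (cS * EW)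
  constructor
  · have h := H1 u v (fun x => f1 ‖x‖ * u x * v x) EU EV _ hR hEU hEV eU eV (by
      intro x
      rw [← prof_eq hru x, ← prof_eq hrv x]; ring)
    refine (Hnorm_of_le (by positivity) h).trans ?_
    rw [mU, mV, ← ENNReal.ofReal_mul (by positivity), ← ENNReal.ofReal_mul (by positivity)]
    apply ENNReal.ofReal_le_ofReal
    have e : √(C1 * (EU * EV)) = √(C1 / cS^2) * √(cS * EU) * √(cS * EV) := by
      rw [← Real.sqrt_mul (by positivity), ← Real.sqrt_mul (by positivity)]
      congr 1
      field_simp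
    rw [e]
    gcongr
    linarith [Real.sqrt_nonneg (C2 / cS^3)]
  · have h := H2 u v w (fun x => f2 ‖x‖ * u x * v x * w x) EU EV EW _ hR hEU hEV hEW eU eV eW (by
      intro x
      rw [← prof_eq hru x, ← prof_eq hrv x, ← prof_eq hrw x]; ring)
    refine (Hnorm_of_le (by positivity) h).trans ?_
    rw [mU, mV, mW, ← ENNReal.ofReal_mul (by positivity), ← ENNReal.ofReal_mul (by positivity),
      ← ENNReal.ofReal_mul (by positivity)]
    apply ENNReal.ofReal_le_ofReal
    have e : √(C2 * (EU * EV * EW)) =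
        √(C2 / cS^3) * √(cS * EU) * √(cS * EV) * √(cS * EW) := by
      rw [← Real.sqrt_mul (by positivity), ← Real.sqrt_mul (by positivity),
        ← Real.sqrt_mul (by positivity)]
      congr 1
      field_simp
    rw [e]
    gcongr
    linarith [Real.sqrt_nonneg (C1 / cS^2)]

end
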